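/- Let ξ be an injective primitive substitution of constant length q on a finite alphabet A with |A| > 1, such that for some α ∈ A the word ξ(α) begins with α, and let u ∈ A^{ℕ₀} be the infinite fixed point of ξ starting with α. Let (X_ξ, μ^ξ, T) be the associated uniquely ergodic substitutional dynamical system (T the left shift, X_ξ the orbit closure of u, μ^ξ the unique T-invariant Borel probability measure). Then the sequence h_n = 1 + (c(ξ) − h(ξ))·log n is a scaling entropy sequence of (X_ξ, μ^ξ, T), where h(ξ) is the height and c(ξ) the column number of ξ. -/

import Mathlib

open MeasureTheory Filter Set
open scoped ENNReal

/-- A semimetric on a set: symmetric, nonnegative, vanishing on the diagonal,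
satisfying the triangle inequality. -/
structure IsSemimetric {Y : Type*} (ρ : Y → Y → ℝ) : Prop where
  refl : ∀ x, ρ x x = 0
  symm : ∀ x y, ρ x y = ρ y x
  nonneg : ∀ x y, 0 ≤ ρ x y
  triangle : ∀ x y z, ρ x z ≤ ρ x y + ρ y z

/-- `ρ` is separable on the set `s`: some countable subset of `s` is `ρ`-dense in `s`. -/
def SeparableWRT {Y : Type*} (ρ : Y → Y → ℝ) (s : Set Y) : Prop :=
  ∃ D : Set Y, D.Countable ∧ D ⊆ s ∧ ∀ x ∈ s, ∀ ε : ℝ, 0 < ε → ∃ y ∈ D, ρ x y < ε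

variable {X : Type*} [MeasurableSpace X]

/-- A semimetric is admissible if it is separable on a measurable subset of full measure. -/
def IsAdmissible (μ : Measure X) (ρ : X → X → ℝ) : Prop :=
  ∃ s : Set X, MeasurableSet s ∧ μ sᶜ = 0 ∧ SeparableWRT ρ s

/-- There is a partition `X₀, X₁, …, X_k` of `X` into measurable pieces with `μ X₀ < ε`
and the `ρ`-diameter of `X_j` (1 ≤ j ≤ k) less than `ε`. -/
def IsEntropyPartition (μ : Measure X) (ρ : X → X → ℝ) (ε : ℝ) (k : ℕ) : Prop :=
  ∃ P : Fin (k + 1) → Set X,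
    (∀ j, MeasurableSet (P j)) ∧
    Pairwise (fun i j => Disjoint (P i) (P j)) ∧
    (⋃ j, P j) = Set.univ ∧
    μ (P 0) < ENNReal.ofReal ε ∧
    ∀ j, j ≠ 0 → ∀ x ∈ P j, ∀ y ∈ P j, ρ x y < ε

open scoped Classical in
/-- The Kolmogorov ε-entropy `ℍ_ε(X, μ, ρ)` of a semimetric triple: `log₂ k` for the least
`k` admitting an entropy partition, and `∞` if there is none. -/
noncomputable def epsEntropy (μ : Measure X) (ρ : X → X → ℝ) (ε : ℝ) : ℝ≥0∞ :=
  if h : ∃ k, IsEntropyPartition μ ρ ε k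
  then ENNReal.ofReal (Real.logb 2 (Nat.find h))
  else ⊤

/-- The average `T^n_av ρ = (1/n) ∑_{k=0}^{n-1} T^k ρ`, where `T^k ρ (x, y) = ρ (T^k x, T^k y)`
(one-sided version, for a not necessarily invertible transformation `T`). -/
noncomputable def avgSemimetricM (T : X → X) (ρ : X → X → ℝ) (n : ℕ) : X → X → ℝ :=
  fun x y => (∑ k ∈ Finset.range n, ρ (T^[k] x) (T^[k] y)) / n

/-- `h` is a scaling sequence for the semimetric `ρ` w.r.t. the transformation `T`:
`h` is positive, for every `ε > 0` the sequence `ℍ_ε(X, μ, T^n_av ρ)/h_n` has finite limsup,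
and for all sufficiently small `ε > 0` it has positive liminf. Sequences are indexed by
`n = 1, 2, …`. -/
def IsScalingSeqM (μ : Measure X) (T : X → X) (ρ : X → X → ℝ) (h : ℕ → ℝ) : Prop :=
  (∀ n, 1 ≤ n → 0 < h n) ∧
  (∀ ε : ℝ, 0 < ε →
    Filter.limsup (fun n : ℕ =>
      epsEntropy μ (avgSemimetricM T ρ n) ε / ENNReal.ofReal (h n)) Filter.atTop < ⊤) ∧
  (∃ ε₀ : ℝ, 0 < ε₀ ∧ ∀ ε : ℝ, 0 < ε → ε < ε₀ →
    0 < Filter.liminf (fun n : ℕ =>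
      epsEntropy μ (avgSemimetricM T ρ n) ε / ENNReal.ofReal (h n)) Filter.atTop)

/-- `ρ` is generating for `(X, μ, T)`: the shifts `T^k ρ` separate points of a subset of full
measure (one-sided version). -/
def IsGeneratingM (μ : Measure X) (T : X → X) (ρ : X → X → ℝ) : Prop :=
  ∃ s : Set X, MeasurableSet s ∧ μ sᶜ = 0 ∧
    ∀ x ∈ s, ∀ y ∈ s, x ≠ y → ∃ k : ℕ, 0 < ρ (T^[k] x) (T^[k] y)

/-- `h` is a scaling entropy sequence of the system `(X, μ, T)`: it is a scaling sequence for
some summable admissible measurable generating semimetric. -/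
def IsScalingEntropySeqM (μ : Measure X) (T : X → X) (h : ℕ → ℝ) : Prop :=
  ∃ ρ : X → X → ℝ, IsSemimetric ρ ∧
    Measurable (fun p : X × X => ρ p.1 p.2) ∧
    MeasureTheory.Integrable (fun p : X × X => ρ p.1 p.2) (μ.prod μ) ∧
    IsAdmissible μ ρ ∧ IsGeneratingM μ T ρ ∧ IsScalingSeqM μ T ρ h

/-- The Koopman operator `f ↦ f ∘ T` on `L²(X, μ)` has purely point spectrum: `L²(X, μ)`
possesses an orthonormal (Hilbert) basis consisting of eigenfunctions of `f ↦ f ∘ T`. -/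
def HasPurePointSpectrum (μ : Measure X) (T : X → X) : Prop :=
  ∃ (ι : Type) (b : HilbertBasis ι ℂ (MeasureTheory.Lp ℂ 2 μ)),
    ∀ i : ι, ∃ c : ℂ, (fun x => (b i : MeasureTheory.Lp ℂ 2 μ) (T x))
      =ᵐ[μ] fun x => c * (b i : MeasureTheory.Lp ℂ 2 μ) x

/-- The action of a substitution `ξ` of constant length `q` on one-sided infinite words:
the `j`-th letter of `ξ(u)` is the `(j % q)`-th letter of `ξ` applied to the `(j / q)`-th
letter of `u`. -/
def substApply {A : Type*} {q : ℕ} (hq : 0 < q) (ξ : A → Fin q → A) (u : ℕ → A) : ℕ → A :=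
  fun j => ξ (u (j / q)) ⟨j % q, Nat.mod_lt j hq⟩

/-- A substitution of constant length `q` is primitive if for some `n ≥ 1` the word `ξⁿ(a)`
contains every letter of the alphabet, for every letter `a`.  Here `ξⁿ(a)` is read off as the
first `qⁿ` letters of the `n`-th iterate of `ξ` on any word starting with `a`. -/
def IsPrimitiveSubst {A : Type*} {q : ℕ} (hq : 0 < q) (ξ : A → Fin q → A) : Prop :=
  ∃ n : ℕ, 0 < n ∧ ∀ a b : A, ∃ k : ℕ, k < q ^ n ∧ (substApply hq ξ)^[n] (fun _ => a) k = b

/-- The height `h(ξ)` of a constant length `q` substitution with fixed point `u`: the greatest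
`k` relatively prime to `q` such that `u_n = u_0` implies `k ∣ n`. -/
noncomputable def substHeight {A : Type*} {q : ℕ} (hq : 0 < q) (ξ : A → Fin q → A)
    (u : ℕ → A) : ℕ :=
  sSup {k : ℕ | Nat.Coprime k q ∧ ∀ n : ℕ, u n = u 0 → k ∣ n}

/-- The column number `c(ξ)`: the minimum over `n ≥ 1` and `0 ≤ k < qⁿ` of the number of
distinct letters `ξⁿ(a)_k`, `a ∈ A`. -/
noncomputable def substColumnNumber {A : Type*} [Fintype A] [DecidableEq A] {q : ℕ}
    (hq : 0 < q) (ξ : A → Fin q → A) : ℕ :=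
  sInf {m : ℕ | ∃ n : ℕ, 0 < n ∧ ∃ k : ℕ, k < q ^ n ∧
    m = (Finset.univ.image fun a : A => (substApply hq ξ)^[n] (fun _ => a) k).card}

/-- The left shift on one-sided infinite words. -/
def shiftMap (A : Type*) : (ℕ → A) → (ℕ → A) := fun x n => x (n + 1)

/-- The orbit closure `X_ξ` of the fixed point `u` under the left shift, in the product
topology. -/
def substOrbitClosure (A : Type*) [TopologicalSpace A] (u : ℕ → A) : Set (ℕ → A) :=
  closure {x : ℕ → A | ∃ n : ℕ, x = (shiftMap A)^[n] u}

/-! ### Combinatorics of the substitution -/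

section Comb

variable {A : Type*}

/-- The word `ξ^m(a)`, read at position `k`. -/
def sW {q : ℕ} (hq : 0 < q) (ξ : A → Fin q → A) (m : ℕ) (a : A) (k : ℕ) : A :=
  (substApply hq ξ)^[m] (fun _ => a) k

theorem iter_apply {q : ℕ} (hq : 0 < q) (ξ : A → Fin q → A) (m : ℕ) (w : ℕ → A) (t j : ℕ)
    (hj : j < q ^ m) : (substApply hq ξ)^[m] w (q ^ m * t + j) = sW hq ξ m (w t) j := by
  unfold sW
  induction m generalizing j with
  | zero =>
    have : j = 0 := by simpa using hj
    simp [this]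
  | succ m ih =>
    rw [Function.iterate_succ_apply', Function.iterate_succ_apply']
    have h1 : (q ^ (m + 1) * t + j) / q = q ^ m * t + j / q := by
      rw [pow_succ, mul_comm (q ^ m) q, mul_assoc, Nat.mul_add_div hq]
    have h2 : (q ^ (m + 1) * t + j) % q = j % q := by
      rw [pow_succ, mul_comm (q ^ m) q, mul_assoc, Nat.mul_add_mod]
    have h3 : j / q < q ^ m := by
      rw [Nat.div_lt_iff_lt_mul hq]; rwa [pow_succ] at hj
    have h4 := ih (j / q) h3
    simp only [substApply, h1, h2]
    rw [h4]

theorem sW_add {q : ℕ} (hq : 0 < q) (ξ : A → Fin q → A) (m n : ℕ) (a : A) (k j : ℕ)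
    (hj : j < q ^ n) : sW hq ξ (m + n) a (q ^ n * k + j) = sW hq ξ n (sW hq ξ m a k) j := by
  rw [← iter_apply hq ξ n (sW hq ξ m a) k j hj]
  unfold sW
  rw [add_comm, Function.iterate_add_apply]

theorem u_block {q : ℕ} (hq : 0 < q) (ξ : A → Fin q → A) {u : ℕ → A}
    (hufix : substApply hq ξ u = u) (m t j : ℕ) (hj : j < q ^ m) :
    u (q ^ m * t + j) = sW hq ξ m (u t) j := by
  rw [← iter_apply hq ξ m u t j hj]
  rw [Function.iterate_fixed hufix m]

theorem two_le_q [Fintype A] (hcard : 1 < Fintype.card A) {q : ℕ} (hq : 0 < q)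
    (ξ : A → Fin q → A) (hprim : IsPrimitiveSubst hq ξ) : 2 ≤ q := by
  by_contra hlt
  have h1 : q = 1 := by omega
  obtain ⟨n, -, h⟩ := hprim
  obtain ⟨a, b, hab⟩ := Fintype.one_lt_card_iff.1 hcard
  obtain ⟨k, hk, h2⟩ := h a a
  obtain ⟨k', hk', h3⟩ := h a b
  have e1 : q ^ n = 1 := by rw [h1, one_pow]
  rw [e1] at hk hk'
  have : k = k' := by omega
  subst this
  exact hab (h2.symm.trans h3)

/-- Every letter occurs in `u` with bounded gaps. -/
theorem letter_gap {q : ℕ} (hq : 0 < q) (ξ : A → Fin q → A) (hprim : IsPrimitiveSubst hq ξ)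
    {u : ℕ → A} (hufix : substApply hq ξ u = u) :
    ∃ G : ℕ, 0 < G ∧ ∀ (a : A) (y₀ : ℕ), ∃ y, y₀ ≤ y ∧ y < y₀ + G ∧ u y = a := by
  obtain ⟨n, hn, h⟩ := hprim
  have hpos : 0 < q ^ n := pow_pos hq n
  refine ⟨2 * q ^ n, by omega, fun a y₀ => ?_⟩
  obtain ⟨k, hk, hka⟩ := h (u (y₀ / q ^ n + 1)) a
  refine ⟨q ^ n * (y₀ / q ^ n + 1) + k, ?_, ?_, ?_⟩
  · have := Nat.lt_mul_div_succ y₀ hpos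
    omega
  · have := Nat.mul_div_le y₀ (q ^ n)
    rw [mul_add]
    omega
  · rw [u_block hq ξ hufix _ _ _ hk]; exact hka

theorem letter_occ {q : ℕ} (hq : 0 < q) (ξ : A → Fin q → A) (hprim : IsPrimitiveSubst hq ξ)
    {u : ℕ → A} (hufix : substApply hq ξ u = u) (a : A) : ∃ i, u i = a := by
  obtain ⟨G, -, h⟩ := letter_gap hq ξ hprim hufix
  obtain ⟨y, -, -, hy⟩ := h a 0
  exact ⟨y, hy⟩

/-! Height. -/

theorem height_bdd {q : ℕ} (hq : 0 < q) (ξ : A → Fin q → A) (hprim : IsPrimitiveSubst hq ξ)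
    {u : ℕ → A} (hufix : substApply hq ξ u = u) :
    BddAbove {k : ℕ | Nat.Coprime k q ∧ ∀ n : ℕ, u n = u 0 → k ∣ n} := by
  obtain ⟨G, -, h⟩ := letter_gap hq ξ hprim hufix
  obtain ⟨y, hy, -, hyu⟩ := h (u 0) 1
  exact ⟨y, fun k hk => Nat.le_of_dvd hy (hk.2 y hyu)⟩

theorem height_mem {q : ℕ} (hq : 0 < q) (ξ : A → Fin q → A) (hprim : IsPrimitiveSubst hq ξ)
    {u : ℕ → A} (hufix : substApply hq ξ u = u) :
    Nat.Coprime (substHeight hq ξ u) q ∧ ∀ n : ℕ, u n = u 0 → substHeight hq ξ u ∣ n :=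
  Nat.sSup_mem (s := {k : ℕ | Nat.Coprime k q ∧ ∀ n : ℕ, u n = u 0 → k ∣ n})
    ⟨1, by simp, by simp⟩ (height_bdd hq ξ hprim hufix)

theorem height_pos {q : ℕ} (hq : 0 < q) (ξ : A → Fin q → A) (hprim : IsPrimitiveSubst hq ξ)
    {u : ℕ → A} (hufix : substApply hq ξ u = u) : 0 < substHeight hq ξ u :=
  le_csSup (height_bdd hq ξ hprim hufix) ⟨by simp, by simp⟩

theorem height_modEq {q : ℕ} (hq : 0 < q) (ξ : A → Fin q → A) (hprim : IsPrimitiveSubst hq ξ)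
    {u : ℕ → A} (hufix : substApply hq ξ u = u) {i j : ℕ} (hij : u i = u j) :
    i ≡ j [MOD substHeight hq ξ u] := by
  obtain ⟨hc, hd⟩ := height_mem hq ξ hprim hufix
  obtain ⟨n, -, h⟩ := hprim
  obtain ⟨k, hk, hka⟩ := h (u i) (u 0)
  have h1 : u (q ^ n * i + k) = u 0 := by rw [u_block hq ξ hufix _ _ _ hk]; exact hka
  have h2 : u (q ^ n * j + k) = u 0 := by rw [u_block hq ξ hufix _ _ _ hk, ← hij]; exact hka
  have h3 : q ^ n * i + k ≡ q ^ n * j + k [MOD substHeight hq ξ u] :=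
    ((Nat.modEq_zero_iff_dvd.2 (hd _ h1))).trans (Nat.modEq_zero_iff_dvd.2 (hd _ h2)).symm
  have h4 := Nat.ModEq.add_right_cancel' k h3
  exact Nat.ModEq.cancel_left_of_coprime (hc.pow_right n) h4

/-! Columns. -/

variable [Fintype A] [DecidableEq A]

theorem column_le {q : ℕ} (hq : 0 < q) (ξ : A → Fin q → A) (m k : ℕ) (hm : 0 < m)
    (hk : k < q ^ m) :
    substColumnNumber hq ξ ≤ (Finset.univ.image fun a : A => sW hq ξ m a k).card :=
  Nat.sInf_le ⟨m, hm, k, hk, rfl⟩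

theorem column_attained {q : ℕ} (hq : 0 < q) (ξ : A → Fin q → A) :
    ∃ m k : ℕ, 0 < m ∧ k < q ^ m ∧
      (Finset.univ.image fun a : A => sW hq ξ m a k).card = substColumnNumber hq ξ := by
  have := Nat.sInf_mem (s := {m : ℕ | ∃ n : ℕ, 0 < n ∧ ∃ k : ℕ, k < q ^ n ∧
    m = (Finset.univ.image fun a : A => (substApply hq ξ)^[n] (fun _ => a) k).card})
    ⟨_, 1, one_pos, 0, by simpa using hq, rfl⟩
  obtain ⟨n, hn, k, hk, h⟩ := this
  exact ⟨n, k, hn, hk, h.symm⟩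

/-- Columns are injective on a minimal column. -/
theorem column_inj {q : ℕ} (hq : 0 < q) (ξ : A → Fin q → A) {m₀ k₀ : ℕ} (hm₀ : 0 < m₀)
    (hk₀ : k₀ < q ^ m₀)
    (hc : (Finset.univ.image fun a : A => sW hq ξ m₀ a k₀).card = substColumnNumber hq ξ)
    (m k : ℕ) (hk : k < q ^ m) (a b : A)
    (h : sW hq ξ m (sW hq ξ m₀ a k₀) k = sW hq ξ m (sW hq ξ m₀ b k₀) k) :
    sW hq ξ m₀ a k₀ = sW hq ξ m₀ b k₀ := by
  have hlt : q ^ m * k₀ + k < q ^ (m₀ + m) := by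
    calc q ^ m * k₀ + k < q ^ m * k₀ + q ^ m := by omega
      _ = q ^ m * (k₀ + 1) := by ring
      _ ≤ q ^ m * q ^ m₀ := Nat.mul_le_mul_left _ hk₀
      _ = q ^ (m₀ + m) := by rw [pow_add, mul_comm]
  have h1 := column_le hq ξ (m₀ + m) (q ^ m * k₀ + k) (by omega) hlt
  have h2 : (Finset.univ.image fun a : A => sW hq ξ (m₀ + m) a (q ^ m * k₀ + k)) =
      (Finset.univ.image fun a : A => sW hq ξ m₀ a k₀).image (fun s => sW hq ξ m s k) := by
    rw [Finset.image_image]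
    refine Finset.image_congr fun a _ => ?_
    exact sW_add hq ξ m₀ m a k₀ k hk
  rw [h2, ← hc] at h1
  have h3 := Finset.card_image_iff.1 (le_antisymm Finset.card_image_le h1)
  exact h3 (by simp) (by simp) h

/-- Two residues: the column number is at least the height, and in case of equality the minimal
column only depends on the position modulo the height. -/
theorem height_le_column {q : ℕ} (hq : 0 < q) (ξ : A → Fin q → A)
    (hprim : IsPrimitiveSubst hq ξ) {u : ℕ → A} (hufix : substApply hq ξ u = u)
    {m₀ k₀ : ℕ} (hk₀ : k₀ < q ^ m₀)
    (hc : (Finset.univ.image fun a : A => sW hq ξ m₀ a k₀).card = substColumnNumber hq ξ) :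
    substHeight hq ξ u ≤ substColumnNumber hq ξ ∧
    (substHeight hq ξ u = substColumnNumber hq ξ → ∀ i j : ℕ,
      i ≡ j [MOD substHeight hq ξ u] → sW hq ξ m₀ (u i) k₀ = sW hq ξ m₀ (u j) k₀) := by
  obtain ⟨hcop, -⟩ := height_mem hq ξ hprim hufix
  have hpos := height_pos hq ξ hprim hufix
  have hmod := fun i j => height_modEq hq ξ hprim hufix (i := i) (j := j)
  set H := substHeight hq ξ u
  choose idx hidx using letter_occ hq ξ hprim hufix
  let F : A → ℕ := fun a => idx a % H
  have hF : ∀ i, F (u i) = i % H := fun i => hmod _ _ (hidx (u i))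
  set S := Finset.univ.image fun a : A => sW hq ξ m₀ a k₀ with hS
  have hv : ∀ t, sW hq ξ m₀ (u t) k₀ = u (q ^ m₀ * t + k₀) :=
    fun t => (u_block hq ξ hufix _ _ _ hk₀).symm
  have hsub : Finset.range H ⊆ S.image F := by
    have himg : ((Finset.range H).image fun t => (q ^ m₀ * t + k₀) % H) = Finset.range H := by
      apply Finset.eq_of_subset_of_card_le
      · intro x hx
        obtain ⟨t, -, rfl⟩ := Finset.mem_image.1 hx
        exact Finset.mem_range.2 (Nat.mod_lt _ hpos)
      · rw [Finset.card_image_of_injOn]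
        intro t ht t' ht' h
        have h1 : q ^ m₀ * t + k₀ ≡ q ^ m₀ * t' + k₀ [MOD H] := h
        have h2 := Nat.ModEq.cancel_left_of_coprime (hcop.pow_right m₀)
          (Nat.ModEq.add_right_cancel' k₀ h1)
        exact Nat.ModEq.eq_of_lt_of_lt h2 (by simpa using ht) (by simpa using ht')
    rw [← himg]
    intro x hx
    obtain ⟨t, -, rfl⟩ := Finset.mem_image.1 hx
    refine Finset.mem_image.2 ⟨sW hq ξ m₀ (u t) k₀, by simp [hS], ?_⟩
    rw [hv, hF]
  have hle := Finset.card_le_card hsub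
  rw [Finset.card_range] at hle
  refine ⟨hc ▸ hle.trans Finset.card_image_le, fun heq i j hij => ?_⟩
  have h3 : Set.InjOn F S :=
    Finset.card_image_iff.1 (le_antisymm Finset.card_image_le (by rw [hc, ← heq]; exact hle))
  refine h3 (by simp [hS]) (by simp [hS]) ?_
  rw [hv, hv, hF, hF]
  exact Nat.ModEq.add_right _ (Nat.ModEq.mul_left _ hij)

end Comb
section Aper

variable {A : Type*} [Fintype A] [DecidableEq A]

/-- If the minimal column of `u` is periodic, the column number is at most the height. -/
theorem column_le_height_of_periodic {q : ℕ} (hq : 0 < q) (hq2 : 2 ≤ q) (ξ : A → Fin q → A)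
    (hprim : IsPrimitiveSubst hq ξ) {u : ℕ → A} (hufix : substApply hq ξ u = u)
    {m₀ k₀ : ℕ} (hm₀ : 0 < m₀) (hk₀ : k₀ < q ^ m₀)
    (hc : (Finset.univ.image fun a : A => sW hq ξ m₀ a k₀).card = substColumnNumber hq ξ)
    (hper : ∃ r, 0 < r ∧ ∀ t, sW hq ξ m₀ (u (t + r)) k₀ = sW hq ξ m₀ (u t) k₀) :
    substColumnNumber hq ξ ≤ substHeight hq ξ u := by
  classical
  set v : ℕ → A := fun t => sW hq ξ m₀ (u t) k₀ with hvdef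
  have hv : ∀ t, v t = u (q ^ m₀ * t + k₀) := fun t => (u_block hq ξ hufix _ _ _ hk₀).symm
  have hper' : ∃ r, 0 < r ∧ ∀ t, v (t + r) = v t := hper
  set p := Nat.find hper' with hp
  obtain ⟨hp0, hpp⟩ := Nat.find_spec hper'
  rw [← hp] at hp0 hpp
  have hpmul : ∀ x t, v (t + p * x) = v t := by
    intro x
    induction x with
    | zero => simp
    | succ x ih => intro t; rw [mul_add, mul_one, ← add_assoc, hpp, ih]
  have hvmod : ∀ x, v (x % p) = v x := by
    intro x
    conv_rhs => rw [← Nat.mod_add_div x p]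
    rw [hpmul]
  have hvmod' : ∀ x y, x ≡ y [MOD p] → v x = v y := by
    intro x y h
    rw [← hvmod x, ← hvmod y, h]
  have hdvd : ∀ r, (∀ t, v (t + r) = v t) → p ∣ r := by
    intro r hr
    by_contra hnd
    have h0 : 0 < r % p := Nat.pos_of_ne_zero fun h => hnd (Nat.dvd_of_mod_eq_zero h)
    refine Nat.find_min hper' (m := r % p) (Nat.mod_lt _ hp0) ⟨h0, fun t => ?_⟩
    rw [← hr t]
    exact hvmod' _ _ (Nat.ModEq.add_left _ (Nat.mod_modEq _ _))
  have hvcol : ∀ m k t, k < q ^ m →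
      v (q ^ (m₀ + m) * t + q ^ m * k₀ + k) = sW hq ξ m₀ (sW hq ξ m (v t) k) k₀ := by
    intro m k t hk
    have : q ^ (m₀ + m) * t + q ^ m * k₀ + k = q ^ m * (q ^ m₀ * t + k₀) + k := by ring
    rw [this, hv t, ← u_block hq ξ hufix _ _ _ hk]
  have hvinj : ∀ m k t t', k < q ^ m →
      v (q ^ (m₀ + m) * t + q ^ m * k₀ + k) = v (q ^ (m₀ + m) * t' + q ^ m * k₀ + k) →
      v t = v t' := by
    intro m k t t' hk h
    rw [hvcol _ _ _ hk, hvcol _ _ _ hk, ← sW_add hq ξ m m₀ _ _ _ hk₀,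
      ← sW_add hq ξ m m₀ _ _ _ hk₀] at h
    refine column_inj hq ξ hm₀ hk₀ hc (m + m₀) _ ?_ _ _ h
    calc q ^ m₀ * k + k₀ < q ^ m₀ * k + q ^ m₀ := by omega
      _ = q ^ m₀ * (k + 1) := by ring
      _ ≤ q ^ m₀ * q ^ m := Nat.mul_le_mul_left _ hk
      _ = q ^ (m + m₀) := by rw [pow_add, mul_comm]
  have hcop : Nat.Coprime p q := by
    set d := Nat.gcd p q with hd
    have hd0 : 0 < d := Nat.gcd_pos_of_pos_left _ hp0
    obtain ⟨e, he⟩ : d ∣ p := Nat.gcd_dvd_left _ _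
    obtain ⟨f, hf⟩ : d ∣ q ^ (m₀ + 0) := (Nat.gcd_dvd_right p q).trans (dvd_pow_self _ (by omega))
    have hpe : p ∣ e := by
      refine hdvd e fun t => ?_
      refine hvinj 0 0 _ _ (by simp) (hvmod' _ _ ?_)
      refine Nat.ModEq.add_right _ (Nat.ModEq.add_right _ ?_)
      rw [mul_add]
      have : p ∣ q ^ (m₀ + 0) * e := ⟨f, by rw [hf, he]; ring⟩
      simpa using Nat.ModEq.add_left (q ^ (m₀ + 0) * t) (Nat.modEq_zero_iff_dvd.2 this)
    have he0 : 0 < e := Nat.pos_of_ne_zero fun h => by rw [h] at he; omega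
    have h1 := Nat.le_of_dvd he0 hpe
    have h2 : d * e ≤ 1 * e := by rw [one_mul, ← he]; exact h1
    have h3 := Nat.le_of_mul_le_mul_right h2 he0
    show d = 1
    omega
  have hdist : ∀ t s, v t = v (t + s) → p ∣ s := by
    intro t s h
    obtain ⟨m, hm⟩ : ∃ m, p < q ^ m := ⟨p, Nat.lt_pow_self (by omega)⟩
    have h1 : p ∣ q ^ (m₀ + m) * s := by
      refine hdvd _ fun x => ?_
      set B := q ^ (m₀ + m) * t + q ^ m * k₀ with hB
      obtain ⟨k, hk, hkx⟩ : ∃ k, k < p ∧ B + k ≡ x [MOD p] := by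
        refine ⟨(x + (p - 1) * B) % p, Nat.mod_lt _ hp0, ?_⟩
        calc B + (x + (p - 1) * B) % p ≡ B + (x + (p - 1) * B) [MOD p] :=
              Nat.ModEq.add_left _ (Nat.mod_modEq _ _)
          _ = x + p * B := by
              obtain ⟨p', hp'⟩ : ∃ p', p = p' + 1 := ⟨p - 1, by omega⟩
              rw [hp', Nat.add_sub_cancel]; ring
          _ ≡ x [MOD p] := by simp [Nat.ModEq]
      have hk' : k < q ^ m := hk.trans hm
      have h2 : v (B + k) = v (B + k + q ^ (m₀ + m) * s) := by
        have : B + k + q ^ (m₀ + m) * s = q ^ (m₀ + m) * (t + s) + q ^ m * k₀ + k := by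
          rw [hB]; ring
        rw [this, hB, hvcol _ _ _ hk', hvcol _ _ _ hk', h]
      rw [← hvmod' _ _ hkx, h2]
      exact hvmod' _ _ (Nat.ModEq.add_right _ hkx.symm)
    exact (Nat.Coprime.dvd_mul_left (hcop.pow_right _)).1 h1
  have hcp : substColumnNumber hq ξ ≤ p := by
    rw [← hc]
    calc _ ≤ ((Finset.range p).image v).card := by
          refine Finset.card_le_card fun x hx => ?_
          obtain ⟨a, -, rfl⟩ := Finset.mem_image.1 hx
          obtain ⟨i, rfl⟩ := letter_occ hq ξ hprim hufix a
          exact Finset.mem_image.2 ⟨i % p, Finset.mem_range.2 (Nat.mod_lt _ hp0), hvmod i⟩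
      _ ≤ p := by simpa using Finset.card_image_le (s := Finset.range p) (f := v)
  refine hcp.trans (le_csSup (height_bdd hq ξ hprim hufix) ⟨hcop, fun n hn => ?_⟩)
  refine hdist 0 n ?_
  simp only [hvdef, zero_add, hn]

/-- Non-synchronisation with a shift by one. -/
theorem exists_letter_nonsync {q : ℕ} (hq : 0 < q) (hq2 : 2 ≤ q) (ξ : A → Fin q → A)
    (hprim : IsPrimitiveSubst hq ξ) {u : ℕ → A} (hufix : substApply hq ξ u = u)
    (π : A → A) (hap : ∀ r, 0 < r → ∃ t, π (u (t + r)) ≠ π (u t)) (m₀ : ℕ) :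
    ∃ l, m₀ ≤ l ∧ 0 < l ∧ ∃ a, ∀ b, ∃ k, k + 1 < q ^ l ∧
      π (sW hq ξ l a k) ≠ π (sW hq ξ l b (k + 1)) := by
  classical
  obtain ⟨n, hn, hpr⟩ := hprim
  have hap' : ∀ r, ∃ t, 0 < r → π (u (t + r)) ≠ π (u t) := by
    intro r
    by_cases h : 0 < r
    · obtain ⟨t, ht⟩ := hap r h; exact ⟨t, fun _ => ht⟩
    · exact ⟨0, fun h' => absurd h' h⟩
  choose τ hτ using hap'
  set c := Fintype.card A
  set M := (∑ r ∈ Finset.range (c + 1), τ r) + c + m₀ with hM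
  have hMq : M < q ^ M := Nat.lt_pow_self (by omega)
  refine ⟨n + M, by omega, by omega, ?_⟩
  by_contra hcon
  push Not at hcon
  choose f hf using hcon
  have hit : ∀ i a k, k + i < q ^ (n + M) →
      π (sW hq ξ (n + M) a k) = π (sW hq ξ (n + M) (f^[i] a) (k + i)) := by
    intro i
    induction i with
    | zero => intros; rfl
    | succ i ih =>
      intro a k hk
      rw [ih a k (by omega), Function.iterate_succ_apply', hf _ (k + i) (by omega)]
      rfl
  obtain ⟨i, j, hij, hfij⟩ : ∃ i j : Fin (c + 1), i ≠ j ∧ f^[i] (u 0) = f^[j] (u 0) :=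
    Fintype.exists_ne_map_eq_of_card_lt (fun i : Fin (c + 1) => f^[i] (u 0)) (by simp [c])
  wlog hlt : (i : ℕ) < j generalizing i j
  · refine this j i hij.symm hfij.symm ?_
    have : (i : ℕ) ≠ j := fun h => hij (Fin.ext h)
    omega
  obtain ⟨r, hr⟩ : ∃ r, (j : ℕ) = r + i := ⟨j - i, by omega⟩
  have hr0 : 0 < r := by omega
  have hrc : r ≤ c := by have := j.2; omega
  set b := f^[i] (u 0) with hb
  have hfr : f^[r] b = b := by
    rw [hb, ← Function.iterate_add_apply, ← hr]; exact hfij.symm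
  obtain ⟨k, hk, hkb⟩ := hpr b (u 0)
  have hτle : τ r ≤ ∑ r ∈ Finset.range (c + 1), τ r :=
    Finset.single_le_sum (f := τ) (fun _ _ => Nat.zero_le _) (Finset.mem_range.2 (by omega))
  have hlt1 : τ r + r < q ^ M := by omega
  have hread : ∀ x, x < q ^ M → sW hq ξ (n + M) b (q ^ M * k + x) = u x := by
    intro x hx
    rw [sW_add hq ξ n M b k x hx]
    have h1 : sW hq ξ n b k = u 0 := hkb
    rw [h1, ← u_block hq ξ hufix M 0 x hx]
    simp
  refine hτ r hr0 ?_
  rw [← hread _ hlt1, ← hread (τ r) (by omega)]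
  have h2 := hit r b (q ^ M * k + τ r) ?_
  · rw [h2, hfr, add_assoc]
  · calc q ^ M * k + τ r + r < q ^ M * k + q ^ M := by omega
      _ = q ^ M * (k + 1) := by ring
      _ ≤ q ^ M * q ^ n := Nat.mul_le_mul_left _ hk
      _ = q ^ (n + M) := by rw [mul_comm, ← pow_add]

end Aper
section Counting

variable {A : Type*} [DecidableEq A]

/-- Hamming distance of the words of length `n` of `u` at positions `t` and `t'`. -/
def ham (u : ℕ → A) (t t' n : ℕ) : ℕ :=
  ((Finset.range n).filter fun x => u (t + x) ≠ u (t' + x)).card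

theorem ham_add (u : ℕ → A) (t t' a b : ℕ) :
    ham u t t' (a + b) = ham u t t' a + ham u (t + a) (t' + a) b := by
  induction b with
  | zero => simp [ham]
  | succ b ih =>
    rw [← add_assoc]
    unfold ham at *
    rw [Finset.range_add_one, Finset.filter_insert, Finset.range_add_one, Finset.filter_insert,
      ← add_assoc, ← add_assoc]
    split_ifs with h1
    · rw [Finset.card_insert_of_notMem (by simp), Finset.card_insert_of_notMem (by simp), ih]
      ring
    · exact ih

theorem ham_mono (u : ℕ → A) (t t' : ℕ) {a b : ℕ} (h : a ≤ b) : ham u t t' a ≤ ham u t t' b := by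
  obtain ⟨c, rfl⟩ := Nat.exists_eq_add_of_le h
  rw [ham_add]; omega

/-- If each window of length `W` contains `C` differences, so do longer windows proportionally. -/
theorem ham_mul_le (u : ℕ → A) (R : ℕ → ℕ → Prop) (hR : ∀ t t' x, R t t' → R (t + x) (t' + x))
    (W C : ℕ) (h : ∀ t t', R t t' → C ≤ ham u t t' W) (n : ℕ) :
    ∀ t t', R t t' → C * n ≤ ham u t t' (W * n) := by
  induction n with
  | zero => simp
  | succ n ih =>
    intro t t' hr
    rw [mul_add, mul_add, mul_one, mul_one, add_comm, add_comm (W * n), ham_add]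
    exact add_le_add (h _ _ hr) (ih _ _ (hR _ _ _ hr))

/-- Real-valued version. -/
theorem ham_real_lower (u : ℕ → A) (R : ℕ → ℕ → Prop)
    (hR : ∀ t t' x, R t t' → R (t + x) (t' + x))
    (W C : ℕ) (hW : 0 < W) (h : ∀ t t', R t t' → C ≤ ham u t t' W) (n : ℕ) (hn : W ≤ n)
    (t t' : ℕ) (hr : R t t') : (C : ℝ) / (2 * W) * n ≤ ham u t t' n := by
  have h1 := ham_mul_le u R hR W C h (n / W) t t' hr
  have h2 := h1.trans (ham_mono u t t' (Nat.mul_div_le n W))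
  have h3 : (C : ℝ) * ((n / W : ℕ) : ℝ) ≤ ham u t t' n := by exact_mod_cast h2
  have h4 : n ≤ 2 * W * (n / W) := by
    have h5 := Nat.lt_mul_div_succ n hW
    have h6 : 1 ≤ n / W := (Nat.one_le_div_iff hW).2 hn
    nlinarith
  have h4' : (n : ℝ) ≤ 2 * W * ((n / W : ℕ) : ℝ) := by exact_mod_cast h4
  have hW' : (0 : ℝ) < W := by exact_mod_cast hW
  refine le_trans ?_ h3
  rw [div_mul_eq_mul_div, div_le_iff₀ (by positivity)]
  have hC : (0 : ℝ) ≤ C := Nat.cast_nonneg _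
  nlinarith

/-- A set of residues avoiding differences `Q^j` modulo `Q^(j+1)` has at most `(Q-1)^L`
elements. -/
theorem card_avoid (Q : ℕ) (hQ : 2 ≤ Q) (L : ℕ) : ∀ E : Finset ℕ, E ⊆ Finset.range (Q ^ L) →
    (∀ t ∈ E, ∀ t' ∈ E, ∀ j < L, ¬ t' ≡ t + Q ^ j [MOD Q ^ (j + 1)]) →
    E.card ≤ (Q - 1) ^ L := by
  induction L with
  | zero =>
    intro E hE _
    simpa using Finset.card_le_card hE
  | succ L ih =>
    intro E hE hav
    set cl := E.image (fun t => t % Q) with hcl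
    have hclsub : cl ⊆ Finset.range Q := by
      intro x hx
      obtain ⟨t, -, rfl⟩ := Finset.mem_image.1 hx
      exact Finset.mem_range.2 (Nat.mod_lt _ (by omega))
    have hclne : cl ≠ Finset.range Q := by
      intro heq
      have h0 : 0 ∈ cl := by rw [heq]; simp; omega
      have h1 : 1 ∈ cl := by rw [heq]; simp; omega
      obtain ⟨t, ht, ht0⟩ := Finset.mem_image.1 h0
      obtain ⟨t', ht', ht1⟩ := Finset.mem_image.1 h1
      refine hav t ht t' ht' 0 (by omega) ?_
      have e0 : t ≡ 0 [MOD Q] := by simp [Nat.ModEq, ht0]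
      have e1 : t' ≡ 1 [MOD Q] := by
        have : 1 % Q = 1 := Nat.mod_eq_of_lt (by omega)
        simp [Nat.ModEq, ht1, this]
      simpa using e1.trans (by simpa using (e0.add_right 1).symm)
    have hclcard : cl.card ≤ Q - 1 := by
      have := Finset.card_lt_card (Finset.ssubset_iff_subset_ne.2 ⟨hclsub, hclne⟩)
      rw [Finset.card_range] at this
      omega
    have hfib : ∀ c ∈ cl, (E.filter fun t => t % Q = c).card ≤ (Q - 1) ^ L := by
      intro c _
      have hrec : ∀ t ∈ E.filter (fun t => t % Q = c), t = Q * (t / Q) + c := by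
        intro t ht
        rw [← (Finset.mem_filter.1 ht).2, Nat.div_add_mod]
      have hinj : Set.InjOn (fun t => t / Q) (E.filter fun t => t % Q = c : Finset ℕ) := by
        intro t ht t' ht' h
        have h' : t / Q = t' / Q := h
        rw [hrec t ht, hrec t' ht', h']
      rw [← Finset.card_image_of_injOn hinj]
      refine ih _ ?_ ?_
      · intro x hx
        obtain ⟨t, ht, rfl⟩ := Finset.mem_image.1 hx
        have := Finset.mem_range.1 (hE (Finset.mem_filter.1 ht).1)
        exact Finset.mem_range.2 (Nat.div_lt_of_lt_mul (by rwa [pow_succ, mul_comm] at this))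
      · intro x hx x' hx' j hj hmod
        obtain ⟨t, ht, rfl⟩ := Finset.mem_image.1 hx
        obtain ⟨t', ht', rfl⟩ := Finset.mem_image.1 hx'
        refine hav t (Finset.mem_filter.1 ht).1 t' (Finset.mem_filter.1 ht').1 (j + 1) (by omega) ?_
        have h1 := (Nat.ModEq.mul_left' Q hmod).add_right c
        rw [← hrec t' ht', mul_add, add_right_comm, ← hrec t ht, ← pow_succ', ← pow_succ'] at h1
        exact h1
    rw [Finset.card_eq_sum_card_image (fun t => t % Q) E]
    calc _ ≤ ∑ c ∈ cl, (Q - 1) ^ L := Finset.sum_le_sum hfib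
      _ = cl.card * (Q - 1) ^ L := by simp
      _ ≤ (Q - 1) * (Q - 1) ^ L := Nat.mul_le_mul_right _ hclcard
      _ = (Q - 1) ^ (L + 1) := by rw [pow_succ']

/-- Number of residues none of whose digits is `k₀`. -/
theorem card_bad (P k₀ : ℕ) (hk₀ : k₀ < P) (M : ℕ) :
    ((Finset.range (P ^ M)).filter fun x => ∀ d < M, (x / P ^ d) % P ≠ k₀).card ≤ (P - 1) ^ M := by
  induction M with
  | zero => simp
  | succ M ih =>
    have hP : 0 < P := by omega
    calc _ ≤ (((Finset.range P).erase k₀) ×ˢ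
          ((Finset.range (P ^ M)).filter fun x => ∀ d < M, (x / P ^ d) % P ≠ k₀)).card := by
          refine Finset.card_le_card_of_injOn (fun x => (x % P, x / P)) ?_ ?_
          · intro x hx
            have hx' := Finset.mem_filter.1 (Finset.mem_coe.1 hx)
            have hlt := Finset.mem_range.1 hx'.1
            refine Finset.mem_coe.2 (Finset.mem_product.2 ⟨Finset.mem_erase.2 ⟨?_, ?_⟩,
              Finset.mem_filter.2 ⟨?_, ?_⟩⟩)
            · simpa using hx'.2 0 (by omega)
            · exact Finset.mem_range.2 (Nat.mod_lt _ hP)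
            · exact Finset.mem_range.2 (Nat.div_lt_of_lt_mul (by rwa [pow_succ, mul_comm] at hlt))
            · intro d hd
              have := hx'.2 (d + 1) (by omega)
              rwa [pow_succ', ← Nat.div_div_eq_div_mul] at this
          · intro x _ y _ h
            obtain ⟨h1, h2⟩ := Prod.mk.inj h
            rw [← Nat.div_add_mod x P, ← Nat.div_add_mod y P, h1, h2]
      _ = (P - 1) * _ := by
          rw [Finset.card_product, Finset.card_erase_of_mem (Finset.mem_range.2 hk₀),
            Finset.card_range]
      _ ≤ (P - 1) * (P - 1) ^ M := Nat.mul_le_mul_left _ ih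
      _ = (P - 1) ^ (M + 1) := by rw [pow_succ']

theorem card_window_periodic (p : ℕ → Prop) [DecidablePred p] (W : ℕ) (hW : 0 < W)
    (hp : Function.Periodic p W) (i n : ℕ) :
    ((Finset.range n).filter fun x => p (i + x)).card ≤
      (n / W + 1) * ((Finset.range W).filter p).card := by
  have key : ∀ R i, ((Finset.range (R * W)).filter fun x => p (i + x)).card
      = R * ((Finset.range W).filter p).card := by
    intro R
    induction R with
    | zero => simp
    | succ R ih =>
      intro i
      have h1 : Finset.range ((R + 1) * W) =
          Finset.range W ∪ (Finset.range (R * W)).map (addRightEmbedding W) := by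
        ext x
        simp only [Finset.mem_range, Finset.mem_union, Finset.mem_map, addRightEmbedding_apply]
        rw [add_mul, one_mul]
        constructor
        · intro h
          by_cases hx : x < W
          · exact Or.inl hx
          · exact Or.inr ⟨x - W, by omega, by omega⟩
        · rintro (h | ⟨y, hy, rfl⟩) <;> [skip; skip] <;> nlinarith
      rw [h1, Finset.filter_union, Finset.card_union_of_disjoint]
      · rw [Finset.filter_map, Finset.card_map]
        have h2 : ((fun x => p (i + x)) ∘ (addRightEmbedding W)) = fun x => p (i + x) := by
          funext x
          simp only [Function.comp, addRightEmbedding_apply]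
          rw [← add_assoc, hp]
        simp only [h2]
        rw [ih i, add_mul, one_mul, add_comm]
        congr 1
        have h3 := Nat.filter_Ico_card_eq_of_periodic i W p hp
        rw [Nat.count_eq_card_filter_range] at h3
        rw [← h3]
        have h4 : Finset.Ico i (i + W) = (Finset.range W).map (addLeftEmbedding i) := by
          ext x
          simp only [Finset.mem_Ico, Finset.mem_map, Finset.mem_range, addLeftEmbedding_apply]
          constructor
          · rintro ⟨h, h'⟩; exact ⟨x - i, by omega, by omega⟩
          · rintro ⟨y, hy, rfl⟩; omega
        rw [h4, Finset.filter_map, Finset.card_map]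
        rfl
      · refine Finset.disjoint_filter_filter ?_
        rw [Finset.disjoint_left]
        intro x hx hx'
        simp only [Finset.mem_range, Finset.mem_map, addRightEmbedding_apply] at hx hx'
        obtain ⟨y, _, rfl⟩ := hx'
        omega
  rw [← key (n / W + 1) i]
  refine Finset.card_le_card (Finset.filter_subset_filter _ ?_)
  intro x hx
  have h1 := Nat.lt_mul_div_succ n hW
  have h2 := Finset.mem_range.1 hx
  rw [mul_comm] at h1
  exact Finset.mem_range.2 (h2.trans h1)

end Counting
section HamBounds

variable {A : Type*} [Fintype A] [DecidableEq A]

/-- Lower bound for Hamming distances when the column number exceeds the height. -/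
theorem lower_ham {q : ℕ} (hq : 0 < q) (hq2 : 2 ≤ q) (ξ : A → Fin q → A)
    (hprim : IsPrimitiveSubst hq ξ) {u : ℕ → A} (hufix : substApply hq ξ u = u)
    (hlt : substHeight hq ξ u < substColumnNumber hq ξ) :
    ∃ Q G : ℕ, 2 ≤ Q ∧ 0 < G ∧ ∃ ε₀ : ℝ, 0 < ε₀ ∧ ∀ j t t' n : ℕ,
      t' ≡ t + Q ^ j [MOD Q ^ (j + 1)] → G * Q ^ (j + 1) ≤ n → ε₀ * n ≤ ham u t t' n := by
  obtain ⟨m₀, k₀, hm₀, hk₀, hc⟩ := column_attained hq ξ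
  set π : A → A := fun a => sW hq ξ m₀ a k₀ with hπ
  have hap : ∀ r, 0 < r → ∃ t, π (u (t + r)) ≠ π (u t) := by
    intro r hr
    by_contra hcon
    push Not at hcon
    have := column_le_height_of_periodic hq hq2 ξ hprim hufix hm₀ hk₀ hc ⟨r, hr, hcon⟩
    omega
  obtain ⟨l, hl, hl0, a, ha⟩ := exists_letter_nonsync hq hq2 ξ hprim hufix π hap m₀
  obtain ⟨G, hG, hgap⟩ := letter_gap hq ξ hprim hufix
  set Q := q ^ l with hQ
  have hQ2 : 2 ≤ Q := hq2.trans (Nat.le_self_pow (by omega) q)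
  have hQpos : 0 < Q := by omega
  have hq0 : (0 : ℝ) < q := by exact_mod_cast hq
  have hQ0 : (0 : ℝ) < Q := by exact_mod_cast hQpos
  refine ⟨Q, G + 1, hQ2, by omega, 1 / (2 * q ^ m₀ * (G + 1) * Q), by positivity, ?_⟩
  intro j t t' n hmod hn
  obtain ⟨C, hC1, hC2⟩ : ∃ C, Q ^ j ≤ C * q ^ m₀ ∧ ∀ p p', π p ≠ π p' →
      C ≤ ((Finset.range (q ^ (l * j))).filter
        fun w => sW hq ξ (l * j) p w ≠ sW hq ξ (l * j) p' w).card := by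
    rcases Nat.eq_zero_or_pos j with rfl | hj
    · refine ⟨1, by simpa using Nat.one_le_pow _ _ hq, fun p p' hpp => ?_⟩
      refine Finset.card_pos.2 ⟨0, Finset.mem_filter.2 ⟨by simp, ?_⟩⟩
      intro h
      have : p = p' := h
      exact hpp (by rw [this])
    · have hle : m₀ ≤ l * j := hl.trans (Nat.le_mul_of_pos_right l hj)
      obtain ⟨e, he⟩ := Nat.exists_eq_add_of_le hle
      refine ⟨q ^ e, ?_, fun p p' hpp => ?_⟩
      · rw [hQ, ← pow_mul, he, pow_add, mul_comm]
      · conv_lhs => rw [← Finset.card_range (q ^ e)]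
        refine Finset.card_le_card_of_injOn (fun z => q ^ e * k₀ + z) ?_ ?_
        · intro z hz
          have hz' : z < q ^ e := by simpa using hz
          refine Finset.mem_coe.2 (Finset.mem_filter.2 ⟨Finset.mem_range.2 ?_, ?_⟩)
          · calc q ^ e * k₀ + z < q ^ e * k₀ + q ^ e := by omega
              _ = q ^ e * (k₀ + 1) := by ring
              _ ≤ q ^ e * q ^ m₀ := Nat.mul_le_mul_left _ hk₀
              _ = q ^ (l * j) := by rw [he, pow_add, mul_comm]
          · rw [he, sW_add hq ξ m₀ e p k₀ z hz', sW_add hq ξ m₀ e p' k₀ z hz']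
            exact fun h => hpp (column_inj hq ξ hm₀ hk₀ hc e z hz' p p' h)
        · intro z _ z' _ h
          exact Nat.add_left_cancel h
  set B := Q ^ (j + 1) with hB
  have hBpos : 0 < B := pow_pos hQpos _
  have hQj : Q ^ j = q ^ (l * j) := by rw [hQ, ← pow_mul]
  have hBq : B = q ^ (l + l * j) := by rw [hB, hQ, ← pow_mul]; congr 1; ring
  have hBQ : B = Q ^ j * Q := by rw [hB, pow_succ]
  have hQjpos : 0 < Q ^ j := pow_pos hQpos _
  have hQjB : Q ^ j < B := by rw [hBQ]; nlinarith
  have hwin : ∀ t t', t' ≡ t + Q ^ j [MOD B] → C ≤ ham u t t' ((G + 1) * B) := by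
    intro t t' hmod
    obtain ⟨y, hy1, hy2, hya⟩ := hgap a (t / B + 1)
    have hty : t ≤ B * y := by
      have h1 := Nat.lt_mul_div_succ t hBpos
      have h2 : B * (t / B + 1) ≤ B * y := Nat.mul_le_mul_left _ hy1
      omega
    have hyt : B * y + B ≤ t + (G + 1) * B := by
      have h1 := Nat.mul_div_le t B
      have h2 : B * (y + 1) ≤ B * (t / B + 1 + G) := Nat.mul_le_mul_left _ (by omega)
      nlinarith
    obtain ⟨s, hs⟩ := Nat.exists_eq_add_of_le hty
    have hmod2 : (t' + s) % B = Q ^ j := by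
      have h1 : t' + s ≡ t + Q ^ j + s [MOD B] := hmod.add_right s
      have h2 : t + Q ^ j + s = B * y + Q ^ j := by rw [hs]; ring
      rw [h2] at h1
      have h3 : t' + s ≡ Q ^ j [MOD B] := h1.trans (by simp [Nat.ModEq])
      rw [h3, Nat.mod_eq_of_lt hQjB]
    set y' := (t' + s) / B with hy'
    have hs' : t' + s = B * y' + Q ^ j := by rw [← hmod2, Nat.div_add_mod]
    obtain ⟨k, hk, hkne⟩ := ha (u y')
    refine (hC2 _ _ hkne).trans ?_
    unfold ham
    refine Finset.card_le_card_of_injOn (fun w => s + Q ^ j * k + w) ?_ ?_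
    · intro w hw
      obtain ⟨hw1, hw2⟩ := Finset.mem_filter.1 (Finset.mem_coe.1 hw)
      have hw3 : w < q ^ (l * j) := Finset.mem_range.1 hw1
      have hb1 : Q ^ j * k + Q ^ j ≤ B := by
        calc Q ^ j * k + Q ^ j = Q ^ j * (k + 1) := by ring
          _ ≤ Q ^ j * Q := Nat.mul_le_mul_left _ hk.le
          _ = B := hBQ.symm
      have hb2 : Q ^ j * (k + 1) + Q ^ j ≤ B := by
        calc Q ^ j * (k + 1) + Q ^ j = Q ^ j * (k + 1 + 1) := by ring
          _ ≤ Q ^ j * Q := Nat.mul_le_mul_left _ hk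
          _ = B := hBQ.symm
      have hw4 : w < Q ^ j := by rw [hQj]; exact hw3
      refine Finset.mem_coe.2 (Finset.mem_filter.2 ⟨Finset.mem_range.2 ?_, ?_⟩)
      · show s + Q ^ j * k + w < (G + 1) * B
        omega
      · have e1 : t + (s + Q ^ j * k + w) = q ^ (l + l * j) * y + (q ^ (l * j) * k + w) := by
          rw [← hBq, ← hQj, hs]; ring
        have e2 : t' + (s + Q ^ j * k + w) =
            q ^ (l + l * j) * y' + (q ^ (l * j) * (k + 1) + w) := by
          rw [← hBq, ← hQj]
          calc t' + (s + Q ^ j * k + w) = (t' + s) + Q ^ j * k + w := by ring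
            _ = _ := by rw [hs']; ring
        show u (t + (s + Q ^ j * k + w)) ≠ u (t' + (s + Q ^ j * k + w))
        rw [e1, e2, u_block hq ξ hufix _ _ _ (by rw [← hBq, ← hQj]; omega),
          u_block hq ξ hufix _ _ _ (by rw [← hBq, ← hQj]; omega),
          sW_add hq ξ l (l * j) _ _ _ hw3, sW_add hq ξ l (l * j) _ _ _ hw3, hya]
        exact hw2
    · intro w _ w' _ h
      exact Nat.add_left_cancel h
  have hfin := ham_real_lower u (fun t t' => t' ≡ t + Q ^ j [MOD B])
    (fun t t' x h => by
      have := h.add_right x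
      rwa [add_right_comm] at this)
    ((G + 1) * B) C (by positivity) hwin n hn t t' hmod
  refine le_trans (mul_le_mul_of_nonneg_right ?_ (Nat.cast_nonneg n)) hfin
  have hC1' : (Q : ℝ) ^ j ≤ C * q ^ m₀ := by exact_mod_cast hC1
  rw [div_le_div_iff₀ (by positivity) (by positivity), hBQ]
  push_cast
  have h5 : (0 : ℝ) ≤ 2 * (G + 1) * Q := by positivity
  nlinarith [mul_le_mul_of_nonneg_left hC1' h5]

/-- Upper bound for Hamming distances when the column number equals the height. -/
theorem upper_ham {q : ℕ} (hq : 0 < q) (ξ : A → Fin q → A)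
    (hprim : IsPrimitiveSubst hq ξ) {u : ℕ → A} (hufix : substApply hq ξ u = u)
    (heq : substHeight hq ξ u = substColumnNumber hq ξ) (ε : ℝ) (hε : 0 < ε) :
    ∃ K N : ℕ, 0 < K ∧ ∀ n i i' : ℕ, N ≤ n → i ≡ i' [MOD K] → (ham u i i' n : ℝ) < ε * n := by
  obtain ⟨m₀, k₀, hm₀, hk₀, hc⟩ := column_attained hq ξ
  have hcol := (height_le_column hq ξ hprim hufix hk₀ hc).2 heq
  have hH := height_pos hq ξ hprim hufix
  set H := substHeight hq ξ u
  set P := q ^ m₀ with hP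
  have hPpos : 0 < P := pow_pos hq _
  have hP0 : (0 : ℝ) < P := by exact_mod_cast hPpos
  obtain ⟨M, hM⟩ : ∃ M : ℕ, (1 - 1 / (P : ℝ)) ^ M < ε / 2 := by
    refine exists_pow_lt_of_lt_one (by positivity) ?_
    have : 0 < 1 / (P : ℝ) := by positivity
    linarith
  set W := P ^ M with hW
  have hWpos : 0 < W := pow_pos hPpos _
  obtain ⟨N, hN⟩ := exists_nat_gt (W : ℝ)
  refine ⟨H * W, N, by positivity, fun n i i' hn hmod => ?_⟩
  have hgood : ∀ i i', i ≡ i' [MOD H * W] → u i ≠ u i' → ∀ d < M, (i / P ^ d) % P ≠ k₀ := by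
    intro i i' hmod hne d hd hdig
    apply hne
    have hdvd : ∀ e ≤ M, i / P ^ e ≡ i' / P ^ e [MOD H * P ^ (M - e)] := by
      intro e he
      have h1 : i ≡ i' [MOD P ^ e * (H * P ^ (M - e))] := by
        have : P ^ e * (H * P ^ (M - e)) = H * W := by
          rw [hW, ← Nat.add_sub_cancel' he, pow_add, Nat.add_sub_cancel_left]; ring
        rw [this]; exact hmod
      have h2 : i % P ^ e = i' % P ^ e := h1.of_mul_right _
      have hpe : 0 < P ^ e := pow_pos hPpos e
      refine Nat.ModEq.mul_left_cancel' hpe.ne' (Nat.ModEq.add_right_cancel' (i % P ^ e) ?_)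
      conv_rhs => rw [h2]
      rw [Nat.div_add_mod, Nat.div_add_mod]
      exact h1
    have h1 : (i' / P ^ d) % P = k₀ := by
      rw [← hdig]
      refine (Nat.ModEq.of_dvd ?_ (hdvd d hd.le)).symm
      exact Dvd.dvd.mul_left (dvd_pow_self _ (by omega)) _
    have h2 : i / P ^ (d + 1) ≡ i' / P ^ (d + 1) [MOD H] := (hdvd (d + 1) hd).of_mul_right _
    have h3 : u (i / P ^ d) = u (i' / P ^ d) := by
      have e1 : i / P ^ d = P * (i / P ^ (d + 1)) + k₀ := by
        rw [pow_succ, ← Nat.div_div_eq_div_mul, ← hdig, Nat.div_add_mod]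
      have e2 : i' / P ^ d = P * (i' / P ^ (d + 1)) + k₀ := by
        rw [pow_succ, ← Nat.div_div_eq_div_mul, ← h1, Nat.div_add_mod]
      rw [e1, e2, u_block hq ξ hufix _ _ _ hk₀, u_block hq ξ hufix _ _ _ hk₀]
      exact hcol _ _ h2
    have h4 : i % P ^ d = i' % P ^ d := by
      refine Nat.ModEq.of_dvd ?_ hmod
      exact Dvd.dvd.mul_left (pow_dvd_pow _ hd.le) _
    have hPd : P ^ d = q ^ (m₀ * d) := by rw [hP, pow_mul]
    have hlt : i % P ^ d < q ^ (m₀ * d) := by rw [← hPd]; exact Nat.mod_lt _ (pow_pos hPpos _)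
    rw [← Nat.div_add_mod i (P ^ d), ← Nat.div_add_mod i' (P ^ d), ← h4, hPd,
      u_block hq ξ hufix _ _ _ (by rw [← hPd] at *; exact hlt),
      u_block hq ξ hufix _ _ _ (by rw [← hPd] at *; exact hlt), ← hPd, h3]
  have hper : Function.Periodic (fun x => ∀ d < M, (x / P ^ d) % P ≠ k₀) W := by
    intro x
    have : ∀ d < M, ((x + W) / P ^ d) % P = (x / P ^ d) % P := by
      intro d hd
      have : W = P ^ d * (P * P ^ (M - d - 1)) := by
        rw [hW, ← pow_succ', ← pow_add]; congr 1; omega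
      rw [this, Nat.add_mul_div_left _ _ (pow_pos hPpos d), Nat.add_mul_mod_self_left]
    refine propext ⟨fun h d hd => ?_, fun h d hd => ?_⟩
    · rw [← this d hd]; exact h d hd
    · rw [this d hd]; exact h d hd
  have h1 : ham u i i' n ≤ (n / W + 1) * (P - 1) ^ M := by
    calc ham u i i' n ≤ ((Finset.range n).filter fun x =>
            ∀ d < M, ((i + x) / P ^ d) % P ≠ k₀).card := by
          refine Finset.card_le_card fun x hx => ?_
          obtain ⟨hx1, hx2⟩ := Finset.mem_filter.1 hx
          exact Finset.mem_filter.2 ⟨hx1, hgood _ _ (hmod.add_right x) hx2⟩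
      _ ≤ _ := card_window_periodic _ W hWpos hper i n
      _ ≤ _ := Nat.mul_le_mul_left _ (card_bad P k₀ hk₀ M)
  have h2 : (ham u i i' n : ℝ) ≤ ((n : ℝ) / W + 1) * ((P : ℝ) - 1) ^ M := by
    have h3 : (ham u i i' n : ℝ) ≤ (((n / W : ℕ) : ℝ) + 1) * ((P : ℝ) - 1) ^ M := by
      have : ((P : ℝ) - 1) = ((P - 1 : ℕ) : ℝ) := by
        rw [Nat.cast_sub hPpos]; simp
      rw [this]
      exact_mod_cast h1
    refine h3.trans (mul_le_mul_of_nonneg_right ?_ ?_)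
    · have := Nat.cast_div_le (α := ℝ) (m := n) (n := W)
      linarith
    · have : (1 : ℝ) ≤ P := by exact_mod_cast hPpos
      exact pow_nonneg (by linarith) _
  have hW0 : (0 : ℝ) < W := by exact_mod_cast hWpos
  have h3 : ((P : ℝ) - 1) ^ M = (1 - 1 / (P : ℝ)) ^ M * W := by
    rw [hW]; push_cast; rw [← mul_pow]; congr 1; field_simp
  have hn' : (W : ℝ) < n := by
    have : (N : ℝ) ≤ n := by exact_mod_cast hn
    linarith
  have hpos : 0 < (n : ℝ) / W + 1 := by positivity
  calc (ham u i i' n : ℝ) ≤ ((n : ℝ) / W + 1) * ((1 - 1 / (P : ℝ)) ^ M * W) := by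
        rw [← h3]; exact h2
    _ = (n + W) * (1 - 1 / (P : ℝ)) ^ M := by field_simp
    _ ≤ (n + W) * (ε / 2) := mul_le_mul_of_nonneg_left hM.le (by positivity)
    _ < ε * n := by
        nlinarith

end HamBounds
section Entropy

theorem shift_iter {A : Type*} (k : ℕ) (x : ℕ → A) (m : ℕ) : (shiftMap A)^[k] x m = x (m + k) := by
  induction k generalizing x with
  | zero => rfl
  | succ k ih => rw [Function.iterate_succ_apply, ih]; simp only [shiftMap]; congr 1

variable {A : Type*} [Fintype A] [DecidableEq A]

/-- The cut semimetric comparing the letters at position zero. -/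
def rho0 (x y : ℕ → A) : ℝ := if x 0 = y 0 then 0 else 1

theorem rho0_semimetric : IsSemimetric (rho0 (A := A)) where
  refl x := by simp [rho0]
  symm x y := by simp [rho0, eq_comm]
  nonneg x y := by unfold rho0; split_ifs <;> norm_num
  triangle x y z := by
    unfold rho0
    by_cases h2 : x 0 = y 0
    · rw [h2]; simp
    · rw [if_neg h2]
      split_ifs <;> norm_num

theorem avg_rho0 (n : ℕ) (x y : ℕ → A) : avgSemimetricM (shiftMap A) rho0 n x y =
    (((Finset.range n).filter fun k => x k ≠ y k).card : ℝ) / n := by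
  unfold avgSemimetricM rho0
  congr 1
  rw [Finset.card_filter]
  push_cast
  refine Finset.sum_congr rfl fun k _ => ?_
  rw [shift_iter, shift_iter, zero_add]
  split_ifs with h1 <;> simp_all

theorem avg_rho0_ham (n : ℕ) (x y u : ℕ → A) (i i' : ℕ) (hx : ∀ t < n, x t = u (i + t))
    (hy : ∀ t < n, y t = u (i' + t)) :
    avgSemimetricM (shiftMap A) rho0 n x y = (ham u i i' n : ℝ) / n := by
  rw [avg_rho0]
  congr 2
  unfold ham
  congr 1
  refine Finset.filter_congr fun k hk => ?_
  rw [hx k (Finset.mem_range.1 hk), hy k (Finset.mem_range.1 hk)]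

theorem closure_prefix [TopologicalSpace A] [DiscreteTopology A] (u x : ℕ → A)
    (hx : x ∈ substOrbitClosure A u) (n : ℕ) : ∃ i, ∀ t < n, x t = u (i + t) := by
  have hopen : IsOpen (⋂ t ∈ Finset.range n, (fun y : ℕ → A => y t) ⁻¹' {x t}) :=
    isOpen_biInter_finset fun t _ => (isOpen_discrete _).preimage (continuous_apply t)
  obtain ⟨y, hy1, i, rfl⟩ := mem_closure_iff.1 hx _ hopen (by simp)
  refine ⟨i, fun t ht => ?_⟩
  simp only [Set.mem_iInter, Finset.mem_range] at hy1
  have : (shiftMap A)^[i] u t = x t := hy1 t ht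
  rw [← this, shift_iter, add_comm]

variable [TopologicalSpace A] [DiscreteTopology A] [MeasurableSpace A] [BorelSpace A]

theorem ae_mem_closure (u : ℕ → A) (μ : Measure (ℕ → A)) [IsProbabilityMeasure μ]
    (hμsupp : μ (substOrbitClosure A u) = 1) : μ (substOrbitClosure A u)ᶜ = 0 := by
  have : MeasurableSet (substOrbitClosure A u) := isClosed_closure.measurableSet
  rw [prob_compl_eq_zero_iff this]
  exact hμsupp

/-- Upper bound for the entropy through a classification of positions. -/
theorem partition_of_class (u : ℕ → A) (μ : Measure (ℕ → A)) [IsProbabilityMeasure μ]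
    (hμsupp : μ (substOrbitClosure A u) = 1) (n : ℕ) (hn : 0 < n) (ε : ℝ) (hε : 0 < ε)
    {K : Type*} [Fintype K] (cls : ℕ → K)
    (hcls : ∀ i i', cls i = cls i' → (ham u i i' n : ℝ) < ε * n) :
    IsEntropyPartition μ (avgSemimetricM (shiftMap A) rho0 n) ε (Fintype.card K) := by
  classical
  let g : (Fin n → A) → Fin (Fintype.card K + 1) := fun w =>
    if h : ∃ i, ∀ t : Fin n, w t = u (i + t) then (Fintype.equivFin K (cls h.choose)).succ else 0
  let r : (ℕ → A) → (Fin n → A) := fun x t => x t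
  have hr : Measurable r := measurable_pi_lambda _ fun t => measurable_pi_apply _
  refine ⟨fun j => r ⁻¹' (g ⁻¹' {j}), fun j => hr (Set.toFinite _).measurableSet, ?_, ?_, ?_, ?_⟩
  · intro i j hij
    refine Set.disjoint_left.2 fun x hx hy => hij ?_
    simp only [Set.mem_preimage, Set.mem_singleton_iff] at hx hy
    rw [← hx, ← hy]
  · ext x; simp
  · have : μ (r ⁻¹' (g ⁻¹' {0})) = 0 := by
      refine measure_mono_null (fun x hx => ?_) (ae_mem_closure u μ hμsupp)
      intro hxc
      obtain ⟨i, hi⟩ := closure_prefix u x hxc n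
      have hex : ∃ i, ∀ t : Fin n, r x t = u (i + t) := ⟨i, fun t => hi t t.2⟩
      simp only [Set.mem_preimage, Set.mem_singleton_iff, g, dif_pos hex] at hx
      exact Fin.succ_ne_zero _ hx
    rw [this]
    exact ENNReal.ofReal_pos.2 hε
  · intro j hj x hx y hy
    simp only [Set.mem_preimage, Set.mem_singleton_iff] at hx hy
    have hex : ∃ i, ∀ t : Fin n, r x t = u (i + t) := by
      by_contra h
      simp only [g, dif_neg h] at hx
      exact hj hx.symm
    have hey : ∃ i, ∀ t : Fin n, r y t = u (i + t) := by
      by_contra h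
      simp only [g, dif_neg h] at hy
      exact hj hy.symm
    simp only [g, dif_pos hex] at hx
    simp only [g, dif_pos hey] at hy
    have hcl : cls hex.choose = cls hey.choose := by
      have := Fin.succ_injective _ (hx.trans hy.symm)
      exact (Fintype.equivFin K).injective this
    rw [avg_rho0_ham n x y u hex.choose hey.choose (fun t ht => hex.choose_spec ⟨t, ht⟩)
      (fun t ht => hey.choose_spec ⟨t, ht⟩), div_lt_iff₀ (by exact_mod_cast hn)]
    exact hcls _ _ hcl

/-- Lower bound for the size of partitions. -/
theorem partition_lower (u : ℕ → A) (μ : Measure (ℕ → A)) [IsProbabilityMeasure μ]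
    (hμinv : MeasurePreserving (shiftMap A) μ μ)
    (hμsupp : μ (substOrbitClosure A u) = 1) (n : ℕ) (hn : 0 < n) (ε : ℝ) (N B : ℕ)
    (hB : ∀ (i : ℕ) (E : Finset ℕ), E ⊆ Finset.range N →
      (∀ s ∈ E, ∀ s' ∈ E, (ham u (i + s) (i + s') n : ℝ) < ε * n) → E.card ≤ B)
    (k : ℕ) (hk : IsEntropyPartition μ (avgSemimetricM (shiftMap A) rho0 n) ε k) :
    (N : ℝ) * (1 - ε) ≤ k * B := by
  classical
  obtain ⟨P, hPm, hPd, hPu, hP0, hPdiam⟩ := hk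
  have hsum : ∑ j, μ.real (P j) = 1 := by
    rw [← measureReal_iUnion_fintype hPd hPm, hPu]
    simp
  have hpiece : ∀ j, j ≠ 0 → (N : ℝ) * μ.real (P j) ≤ B := by
    intro j hj
    have hTm : ∀ s, MeasurePreserving ((shiftMap A)^[s]) μ μ := fun s => hμinv.iterate s
    have h1 : (N : ℝ≥0∞) * μ (P j) ≤ B := by
      calc (N : ℝ≥0∞) * μ (P j) = ∑ s ∈ Finset.range N, μ (P j) := by simp
        _ = ∑ s ∈ Finset.range N, ∫⁻ x, ((shiftMap A)^[s] ⁻¹' P j).indicator 1 x ∂μ := by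
            refine Finset.sum_congr rfl fun s _ => ?_
            rw [lintegral_indicator_one ((hTm s).measurable (hPm j)),
              (hTm s).measure_preimage (hPm j).nullMeasurableSet]
        _ = ∫⁻ x, ∑ s ∈ Finset.range N, ((shiftMap A)^[s] ⁻¹' P j).indicator 1 x ∂μ := by
            rw [lintegral_finsetSum]
            intro s _
            exact measurable_one.indicator ((hTm s).measurable (hPm j))
        _ ≤ ∫⁻ _, (B : ℝ≥0∞) ∂μ := by
            refine lintegral_mono_ae ?_
            have hae : ∀ᵐ x ∂μ, x ∈ substOrbitClosure A u := by
              rw [ae_iff]; exact ae_mem_closure u μ hμsupp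
            filter_upwards [hae] with x hx
            obtain ⟨i, hi⟩ := closure_prefix u x hx (n + N)
            have h2 := hB i ((Finset.range N).filter fun s => (shiftMap A)^[s] x ∈ P j)
              (Finset.filter_subset _ _) ?_
            · have : ∑ s ∈ Finset.range N, ((shiftMap A)^[s] ⁻¹' P j).indicator (1 : (ℕ → A) → ℝ≥0∞) x
                  = (((Finset.range N).filter fun s => (shiftMap A)^[s] x ∈ P j).card : ℝ≥0∞) := by
                rw [Finset.card_filter]
                push_cast
                refine Finset.sum_congr rfl fun s _ => ?_
                simp [Set.indicator_apply]
              rw [this]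
              exact_mod_cast h2
            · intro s hs s' hs'
              obtain ⟨hs1, hs2⟩ := Finset.mem_filter.1 hs
              obtain ⟨hs1', hs2'⟩ := Finset.mem_filter.1 hs'
              rw [Finset.mem_range] at hs1 hs1'
              have h3 := hPdiam j hj _ hs2 _ hs2'
              rw [avg_rho0_ham n _ _ u (i + s) (i + s'), div_lt_iff₀ (by exact_mod_cast hn)] at h3
              · exact h3
              · intro t ht
                rw [shift_iter, hi _ (by omega)]; congr 1; omega
              · intro t ht
                rw [shift_iter, hi _ (by omega)]; congr 1; omega
        _ = B := by simp
    have h2 := ENNReal.toReal_mono (by simp) h1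
    simpa [Measure.real] using h2
  have hP0' : μ.real (P 0) ≤ ε := by
    have hε : 0 < ε := by
      by_contra h
      rw [ENNReal.ofReal_of_nonpos (not_lt.1 h)] at hP0
      simp at hP0
    exact ENNReal.toReal_le_of_le_ofReal hε.le hP0.le
  rw [Fin.sum_univ_succ] at hsum
  have h3 : (N : ℝ) * ∑ j : Fin k, μ.real (P j.succ) ≤ k * B := by
    rw [Finset.mul_sum]
    calc _ ≤ ∑ j : Fin k, (B : ℝ) := Finset.sum_le_sum fun j _ => hpiece _ (Fin.succ_ne_zero _)
      _ = k * B := by simp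
  refine le_trans (mul_le_mul_of_nonneg_left ?_ (Nat.cast_nonneg N)) h3
  linarith

theorem entropy_le {Y : Type*} [MeasurableSpace Y] (μ : Measure Y) (ρ : Y → Y → ℝ) (ε : ℝ) (k : ℕ)
    (h : IsEntropyPartition μ ρ ε k) : epsEntropy μ ρ ε ≤ ENNReal.ofReal (Real.logb 2 k) := by
  classical
  have hex : ∃ k, IsEntropyPartition μ ρ ε k := ⟨k, h⟩
  unfold epsEntropy
  rw [dif_pos hex]
  refine ENNReal.ofReal_le_ofReal ?_
  have h1 : Nat.find hex ≤ k := Nat.find_min' hex h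
  rcases Nat.eq_zero_or_pos (Nat.find hex) with h0 | h0
  · rw [h0]
    simp only [Nat.cast_zero, Real.logb_zero]
    rcases Nat.eq_zero_or_pos k with hk | hk
    · simp [hk]
    · exact Real.logb_nonneg (by norm_num) (by exact_mod_cast hk)
  · exact Real.logb_le_logb_of_le (by norm_num) (by exact_mod_cast h0) (by exact_mod_cast h1)

theorem le_entropy {Y : Type*} [MeasurableSpace Y] (μ : Measure Y) (ρ : Y → Y → ℝ) (ε K : ℝ)
    (hK : 0 < K) (h : ∀ k : ℕ, IsEntropyPartition μ ρ ε k → K ≤ k) :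
    ENNReal.ofReal (Real.logb 2 K) ≤ epsEntropy μ ρ ε := by
  classical
  unfold epsEntropy
  split_ifs with hex
  · exact ENNReal.ofReal_le_ofReal (Real.logb_le_logb_of_le (by norm_num) hK
      (h _ (Nat.find_spec hex)))
  · exact le_top

end Entropy
section Final

theorem limsup_fin (ent : ℕ → ℝ≥0∞) (h : ℕ → ℝ) (C : ℝ) (hC : 0 ≤ C)
    (hev : ∀ᶠ n in atTop, ent n ≤ ENNReal.ofReal (C * h n)) :
    Filter.limsup (fun n => ent n / ENNReal.ofReal (h n)) atTop < ⊤ := by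
  refine lt_of_le_of_lt (limsup_le_of_le (a := ENNReal.ofReal C) ?_ ?_) ENNReal.ofReal_lt_top
  · isBoundedDefault
  · filter_upwards [hev] with n hn
    refine ENNReal.div_le_of_le_mul ?_
    rwa [← ENNReal.ofReal_mul hC]

theorem liminf_pos (ent : ℕ → ℝ≥0∞) (h : ℕ → ℝ) (δ : ℝ) (hδ : 0 < δ)
    (hh : ∀ n, 1 ≤ n → 0 < h n)
    (hev : ∀ᶠ n in atTop, ENNReal.ofReal (δ * h n) ≤ ent n) :
    0 < Filter.liminf (fun n => ent n / ENNReal.ofReal (h n)) atTop := by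
  refine lt_of_lt_of_le (ENNReal.ofReal_pos.2 hδ) (le_liminf_of_le ?_ ?_)
  · isBoundedDefault
  · filter_upwards [hev, eventually_ge_atTop 1] with n hn h1
    rw [ENNReal.le_div_iff_mul_le (Or.inl (ENNReal.ofReal_pos.2 (hh n h1)).ne')
      (Or.inl ENNReal.ofReal_ne_top), ← ENNReal.ofReal_mul hδ.le]
    exact hn

variable {A : Type*} [Fintype A] [DecidableEq A]

theorem ham_complexity {q : ℕ} (hq : 0 < q) (ξ : A → Fin q → A)
    {u : ℕ → A} (hufix : substApply hq ξ u = u) (m n i i' : ℕ) (hn : n ≤ q ^ m)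
    (h1 : i % q ^ m = i' % q ^ m) (h2 : u (i / q ^ m) = u (i' / q ^ m))
    (h3 : u (i / q ^ m + 1) = u (i' / q ^ m + 1)) : ham u i i' n = 0 := by
  refine Finset.card_eq_zero.2 (Finset.filter_eq_empty_iff.2 fun x hx => ?_)
  rw [not_not]
  have hxn := Finset.mem_range.1 hx
  have hpos : 0 < q ^ m := pow_pos hq m
  have hr := Nat.mod_lt i hpos
  by_cases hlt : i % q ^ m + x < q ^ m
  · have e1 : i + x = q ^ m * (i / q ^ m) + (i % q ^ m + x) := by
      rw [← add_assoc, Nat.div_add_mod]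
    have e2 : i' + x = q ^ m * (i' / q ^ m) + (i % q ^ m + x) := by
      rw [h1, ← add_assoc, Nat.div_add_mod]
    rw [e1, e2, u_block hq ξ hufix _ _ _ hlt, u_block hq ξ hufix _ _ _ hlt, h2]
  · obtain ⟨z, hz⟩ := Nat.exists_eq_add_of_le (not_lt.1 hlt)
    have hzl : z < q ^ m := by omega
    have e1 : i + x = q ^ m * (i / q ^ m + 1) + z := by
      have := Nat.div_add_mod i (q ^ m)
      rw [mul_add]; omega
    have e2 : i' + x = q ^ m * (i' / q ^ m + 1) + z := by
      have := Nat.div_add_mod i' (q ^ m)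
      rw [mul_add]; omega
    rw [e1, e2, u_block hq ξ hufix _ _ _ hzl, u_block hq ξ hufix _ _ _ hzl, h3]

/-- Consecutive positions are at positive Hamming distance. -/
theorem consecutive_ham (hcard : 1 < Fintype.card A) {q : ℕ} (hq : 0 < q) (hq2 : 2 ≤ q)
    (ξ : A → Fin q → A) (hprim : IsPrimitiveSubst hq ξ)
    {u : ℕ → A} (hufix : substApply hq ξ u = u) :
    ∃ W : ℕ, 0 < W ∧ ∀ t n, W ≤ n → 1 / (2 * (W : ℝ)) * n ≤ ham u t (t + 1) n := by
  obtain ⟨t₀, ht₀⟩ : ∃ t, u t ≠ u (t + 1) := by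
    by_contra hcon
    push Not at hcon
    have hconst : ∀ t, u t = u 0 := by
      intro t
      induction t with
      | zero => rfl
      | succ t ih => rw [← hcon, ih]
    obtain ⟨a, b, hab⟩ := Fintype.one_lt_card_iff.1 hcard
    obtain ⟨i, rfl⟩ := letter_occ hq ξ hprim hufix a
    obtain ⟨j, rfl⟩ := letter_occ hq ξ hprim hufix b
    exact hab ((hconst i).trans (hconst j).symm)
  obtain ⟨G, hG, hgap⟩ := letter_gap hq ξ hprim hufix
  set B := q ^ (t₀ + 1) with hB
  have hBt : t₀ + 1 < B := Nat.lt_pow_self (by omega)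
  have hBpos : 0 < B := by omega
  have hpos : 0 < (G + 1) * B := by positivity
  refine ⟨(G + 1) * B, hpos, fun t n hn => ?_⟩
  have key := ham_real_lower u (fun t t' => t' = t + 1) (fun t t' x h => by rw [h]; ring)
    ((G + 1) * B) 1 hpos ?_ n hn t (t + 1) rfl
  · simpa using key
  · rintro t _ rfl
    obtain ⟨y, hy1, hy2, hya⟩ := hgap (u 0) (t / B + 1)
    have hty : t ≤ B * y := by
      have h1 := Nat.lt_mul_div_succ t hBpos
      have h2 : B * (t / B + 1) ≤ B * y := Nat.mul_le_mul_left _ hy1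
      omega
    have hyt : B * y + B ≤ t + (G + 1) * B := by
      have h1 := Nat.mul_div_le t B
      have h2 : B * (y + 1) ≤ B * (t / B + 1 + G) := Nat.mul_le_mul_left _ (by omega)
      nlinarith
    obtain ⟨s, hs⟩ := Nat.exists_eq_add_of_le hty
    refine Finset.card_pos.2 ⟨s + t₀, Finset.mem_filter.2 ⟨Finset.mem_range.2 (by omega), ?_⟩⟩
    have hrd : ∀ x, x < B → u (B * y + x) = u x := by
      intro x hx
      rw [u_block hq ξ hufix _ _ _ hx, hya, ← u_block hq ξ hufix _ _ _ hx]
      simp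
    have e1 : t + (s + t₀) = B * y + t₀ := by omega
    have e2 : t + 1 + (s + t₀) = B * y + (t₀ + 1) := by omega
    rw [e1, e2, hrd _ (by omega), hrd _ (by omega)]
    exact ht₀

end Final
section Bounds

variable {A : Type*} [Fintype A] [DecidableEq A]
variable [TopologicalSpace A] [DiscreteTopology A] [MeasurableSpace A] [BorelSpace A]

theorem upper_eq {q : ℕ} (hq : 0 < q) (ξ : A → Fin q → A)
    (hprim : IsPrimitiveSubst hq ξ) {u : ℕ → A} (hufix : substApply hq ξ u = u)
    (μ : Measure (ℕ → A)) [IsProbabilityMeasure μ]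
    (hμsupp : μ (substOrbitClosure A u) = 1)
    (heq : substHeight hq ξ u = substColumnNumber hq ξ) (ε : ℝ) (hε : 0 < ε) :
    ∃ C : ℝ, 0 ≤ C ∧ ∀ᶠ n in atTop,
      epsEntropy μ (avgSemimetricM (shiftMap A) rho0 n) ε ≤ ENNReal.ofReal C := by
  obtain ⟨K, N, hK, h⟩ := upper_ham hq ξ hprim hufix heq ε hε
  refine ⟨Real.logb 2 K, Real.logb_nonneg (by norm_num) (by exact_mod_cast hK), ?_⟩
  filter_upwards [eventually_ge_atTop (max N 1)] with n hn
  have h1 := partition_of_class u μ hμsupp n (by omega) ε hε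
    (fun i => (⟨i % K, Nat.mod_lt _ hK⟩ : Fin K)) (fun i i' hi => h n i i' (by omega) (by
      simpa [Nat.ModEq] using hi))
  rw [Fintype.card_fin] at h1
  exact entropy_le μ _ ε K h1

theorem upper_lt {q : ℕ} (hq : 0 < q) (hq2 : 2 ≤ q) (ξ : A → Fin q → A) {u : ℕ → A}
    (hufix : substApply hq ξ u = u)
    (μ : Measure (ℕ → A)) [IsProbabilityMeasure μ]
    (hμsupp : μ (substOrbitClosure A u) = 1)
    (ε : ℝ) (hε : 0 < ε) (D : ℝ) (hD : 1 ≤ D) :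
    ∃ C : ℝ, 0 ≤ C ∧ ∀ᶠ n : ℕ in atTop,
      epsEntropy μ (avgSemimetricM (shiftMap A) rho0 n) ε ≤
        ENNReal.ofReal (C * (1 + D * Real.log n)) := by
  set M : ℝ := q * (Fintype.card A * Fintype.card A : ℕ) with hM
  have hA : 0 < Fintype.card A := Fintype.card_pos_iff.mpr ⟨u 0⟩
  have hA2 : 0 < Fintype.card A * Fintype.card A := Nat.mul_pos hA hA
  have hM1 : 1 ≤ M := by
    have : 1 ≤ q * (Fintype.card A * Fintype.card A) := Nat.mul_pos hq hA2
    rw [hM]; exact_mod_cast this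
  have hl2 : 0 < Real.log 2 := Real.log_pos (by norm_num)
  have hlM : 0 ≤ Real.log M := Real.log_nonneg hM1
  refine ⟨(Real.log M + 1) / Real.log 2, by positivity, ?_⟩
  filter_upwards [eventually_ge_atTop 1] with n hn
  set m := Nat.log q n + 1 with hm
  have hn1 : n < q ^ m := Nat.lt_pow_succ_log_self (by omega) n
  have hn2 : q ^ m ≤ q * n := by
    rw [hm, pow_succ, mul_comm]
    exact Nat.mul_le_mul_left _ (Nat.pow_log_le_self q (by omega))
  have hqm : 0 < q ^ m := pow_pos hq m
  have h1 := partition_of_class u μ hμsupp n (by omega) ε hε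
    (fun i => ((⟨i % q ^ m, Nat.mod_lt _ hqm⟩ : Fin (q ^ m)), u (i / q ^ m), u (i / q ^ m + 1)))
    (fun i i' hi => by
      simp only [Prod.mk.injEq, Fin.mk.injEq] at hi
      rw [ham_complexity hq ξ hufix m n i i' hn1.le hi.1 hi.2.1 hi.2.2]
      have : (0:ℝ) < n := by exact_mod_cast hn
      simp; positivity)
  rw [Fintype.card_prod, Fintype.card_prod, Fintype.card_fin] at h1
  refine (entropy_le μ _ ε _ h1).trans (ENNReal.ofReal_le_ofReal ?_)
  have hnR : (1:ℝ) ≤ n := by exact_mod_cast hn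
  have hln : 0 ≤ Real.log n := Real.log_nonneg hnR
  have hle : ((q ^ m * (Fintype.card A * Fintype.card A) : ℕ) : ℝ) ≤ M * n := by
    have : q ^ m * (Fintype.card A * Fintype.card A) ≤ q * (Fintype.card A * Fintype.card A) * n := by
      calc _ ≤ q * n * (Fintype.card A * Fintype.card A) := Nat.mul_le_mul_right _ hn2
        _ = _ := by ring
    rw [hM]; exact_mod_cast this
  have hpos : (0:ℝ) < ((q ^ m * (Fintype.card A * Fintype.card A) : ℕ) : ℝ) := by
    exact_mod_cast Nat.mul_pos hqm hA2
  have h2 := Real.log_le_log hpos hle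
  rw [Real.log_mul (by linarith) (by linarith)] at h2
  rw [Real.logb, div_mul_eq_mul_div]
  gcongr
  refine h2.trans ?_
  have : Real.log n ≤ D * Real.log n := le_mul_of_one_le_left hln hD
  nlinarith [mul_nonneg hlM (hln.trans this)]

theorem lower_eq (hcard : 1 < Fintype.card A) {q : ℕ} (hq : 0 < q) (hq2 : 2 ≤ q)
    (ξ : A → Fin q → A)
    (hprim : IsPrimitiveSubst hq ξ) {u : ℕ → A} (hufix : substApply hq ξ u = u)
    (μ : Measure (ℕ → A)) [IsProbabilityMeasure μ]
    (hμinv : MeasurePreserving (shiftMap A) μ μ)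
    (hμsupp : μ (substOrbitClosure A u) = 1) :
    ∃ ε₀ : ℝ, 0 < ε₀ ∧ ∀ ε : ℝ, 0 < ε → ε < ε₀ → ∀ᶠ n in atTop,
      ENNReal.ofReal 1 ≤ epsEntropy μ (avgSemimetricM (shiftMap A) rho0 n) ε := by
  obtain ⟨W, hW, h⟩ := consecutive_ham hcard hq hq2 ξ hprim hufix
  have hWR : (0:ℝ) < W := by exact_mod_cast hW
  refine ⟨min (1 / (2 * (W:ℝ))) (1/2), by positivity, fun ε hε hlt => ?_⟩
  have e1 := lt_of_lt_of_le hlt (min_le_left _ _)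
  have e2 := lt_of_lt_of_le hlt (min_le_right _ _)
  filter_upwards [eventually_ge_atTop W] with n hn
  have hn0 : 0 < n := by omega
  have hnR : (0:ℝ) < n := by exact_mod_cast hn0
  have hne : ∀ t, ¬ (ham u t (t+1) n : ℝ) < ε * n := fun t ht => by
    have := h t n hn
    have := mul_lt_mul_of_pos_right e1 hnR
    linarith
  have key : ∀ k : ℕ, IsEntropyPartition μ (avgSemimetricM (shiftMap A) rho0 n) ε k →
      (2:ℝ) ≤ k := by
    intro k hk
    have := partition_lower u μ hμinv hμsupp n hn0 ε 2 1 (by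
      intro i E hE hEE
      by_contra hc
      have : E = Finset.range 2 := Finset.eq_of_subset_of_card_le hE (by simp; omega)
      subst this
      exact hne i (by simpa using hEE 0 (by simp) 1 (by simp))) k hk
    have h3 : (1:ℝ) < k := by push_cast at this; linarith
    have h4 : 1 < k := by exact_mod_cast h3
    exact_mod_cast h4
  have := le_entropy μ _ ε 2 (by norm_num) key
  rwa [Real.logb_self_eq_one (by norm_num)] at this

theorem lower_lt {q : ℕ} (hq : 0 < q) (hq2 : 2 ≤ q)
    (ξ : A → Fin q → A)
    (hprim : IsPrimitiveSubst hq ξ) {u : ℕ → A} (hufix : substApply hq ξ u = u)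
    (μ : Measure (ℕ → A)) [IsProbabilityMeasure μ]
    (hμinv : MeasurePreserving (shiftMap A) μ μ)
    (hμsupp : μ (substOrbitClosure A u) = 1)
    (hlt : substHeight hq ξ u < substColumnNumber hq ξ) (D : ℝ) (hD : 0 ≤ D) :
    ∃ ε₀ : ℝ, 0 < ε₀ ∧ ∀ ε : ℝ, 0 < ε → ε < ε₀ → ∃ δ : ℝ, 0 < δ ∧ ∀ᶠ n : ℕ in atTop,
      ENNReal.ofReal (δ * (1 + D * Real.log n)) ≤
        epsEntropy μ (avgSemimetricM (shiftMap A) rho0 n) ε := by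
  obtain ⟨Q, G, hQ, hG, ε₀, hε₀, h⟩ := lower_ham hq hq2 ξ hprim hufix hlt
  refine ⟨min ε₀ (1/2), by positivity, fun ε hε hlt => ?_⟩
  have e1 := lt_of_lt_of_le hlt (min_le_left _ _)
  have e2 := lt_of_lt_of_le hlt (min_le_right _ _)
  have hQR : (2:ℝ) ≤ Q := by exact_mod_cast hQ
  have hGR : (1:ℝ) ≤ G := by exact_mod_cast hG
  set θ : ℝ := Real.logb 2 ((Q:ℝ) / (Q - 1)) with hθ
  have hθ0 : 0 < θ := Real.logb_pos (by norm_num) (by rw [lt_div_iff₀] <;> linarith)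
  have hlQ : 0 < Real.log Q := Real.log_pos (by linarith)
  have hlG : 0 ≤ Real.log G := Real.log_nonneg hGR
  set c1 : ℝ := 1 + D * (Real.log G + Real.log Q) with hc1
  set c2 : ℝ := D * Real.log Q with hc2
  have hc1p : 0 < c1 := by positivity
  have hc2p : 0 ≤ c2 := by positivity
  refine ⟨θ / (2 * (c1 + c2)), by positivity, ?_⟩
  obtain ⟨L1, hL1⟩ := exists_nat_ge (2 / θ)
  filter_upwards [eventually_ge_atTop (G * Q ^ (L1 + 1))] with n hn
  set L := Nat.log Q (n / G) with hL
  have hLn : L1 + 1 ≤ L := by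
    refine Nat.le_log_of_pow_le (by omega) ?_
    rw [Nat.le_div_iff_mul_le hG]; rw [mul_comm]; exact hn
  have hnG : n / G ≠ 0 := by
    intro h0
    rw [h0] at hL
    simp at hL; omega
  have hQL : Q ^ L ≤ n / G := Nat.pow_log_le_self Q hnG
  have hGQL : G * Q ^ L ≤ n := by
    rw [mul_comm]; exact (Nat.le_div_iff_mul_le hG).mp hQL
  have hnlt : n < G * Q ^ (L + 1) := by
    have := Nat.lt_pow_succ_log_self (b := Q) (by omega) (n / G)
    rw [mul_comm]; exact (Nat.div_lt_iff_lt_mul hG).mp this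
  have hn0 : 0 < n := Nat.lt_of_lt_of_le (by positivity) hGQL
  have hnR : (0:ℝ) < n := by exact_mod_cast hn0
  have hQ1 : (0:ℝ) < (Q:ℝ) - 1 := by linarith
  have key : ∀ k : ℕ, IsEntropyPartition μ (avgSemimetricM (shiftMap A) rho0 n) ε k →
      ((Q:ℝ) / (Q - 1)) ^ L / 2 ≤ k := by
    intro k hk
    have h1 := partition_lower u μ hμinv hμsupp n hn0 ε (Q ^ L) ((Q - 1) ^ L) (by
      intro i E hE hEE
      refine card_avoid Q hQ L E hE ?_
      intro t ht t' ht' j hj hmod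
      have hm : i + t' ≡ (i + t) + Q ^ j [MOD Q ^ (j + 1)] := by
        rw [add_assoc]; exact hmod.add_left i
      have := h j (i + t) (i + t') n hm
        (le_trans (Nat.mul_le_mul_left _ (Nat.pow_le_pow_right (by omega) hj)) hGQL)
      have h2 := hEE t ht t' ht'
      have := mul_lt_mul_of_pos_right e1 hnR
      linarith) k hk
    push_cast [Nat.cast_sub (by omega : 1 ≤ Q)] at h1
    rw [div_pow, div_div, div_le_iff₀ (by positivity)]
    have : (0:ℝ) < (Q:ℝ) ^ L := by positivity
    nlinarith
  refine le_trans (ENNReal.ofReal_le_ofReal ?_) (le_entropy μ _ ε _ (by positivity) key)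
  have hLR : (L1:ℝ) + 1 ≤ L := by exact_mod_cast hLn
  rw [Real.logb_div (by positivity) (by norm_num), Real.logb_pow,
    Real.logb_self_eq_one (by norm_num), ← hθ]
  have hlog : Real.log n ≤ Real.log G + (L + 1) * Real.log Q := by
    have h5 : (n:ℝ) ≤ G * (Q:ℝ) ^ (L + 1) := by exact_mod_cast hnlt.le
    have := Real.log_le_log hnR h5
    rw [Real.log_mul (by positivity) (by positivity), Real.log_pow] at this
    push_cast at this; exact this
  have hh : 1 + D * Real.log n ≤ (c1 + c2) * L := by
    have h6 := mul_le_mul_of_nonneg_left hlog hD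
    have hL1' : (1:ℝ) ≤ L := by
      have : (0:ℝ) ≤ L1 := Nat.cast_nonneg _
      linarith
    have : 1 + D * Real.log n ≤ c1 + c2 * L := by rw [hc1, hc2]; nlinarith
    nlinarith
  have h7 : θ / (2 * (c1 + c2)) * (1 + D * Real.log n) ≤ θ / (2 * (c1 + c2)) * ((c1 + c2) * L) :=
    mul_le_mul_of_nonneg_left hh (by positivity)
  have h8 : θ / (2 * (c1 + c2)) * ((c1 + c2) * L) = θ * L / 2 := by
    field_simp
  have h9 : 2 ≤ θ * L := by
    rw [div_le_iff₀ hθ0] at hL1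
    nlinarith
  nlinarith

end Bounds

/-- For an injective primitive substitution `ξ` of constant length `q` on a finite
alphabet `A`, `|A| > 1`, with fixed point `u` starting with `α`, the sequence
`h_n = 1 + (c(ξ) − h(ξ))·log n` is a scaling entropy sequence of the uniquely ergodic
substitutional system `(X_ξ, μ^ξ, T)`; here `μ^ξ` is the unique shift-invariant probability
measure carried by `X_ξ`. -/
theorem isScalingEntropySeq_subst
    {A : Type*} [Fintype A] [DecidableEq A] [TopologicalSpace A] [DiscreteTopology A]
    [MeasurableSpace A] [BorelSpace A]
    (hcard : 1 < Fintype.card A)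
    {q : ℕ} (hq : 0 < q) (ξ : A → Fin q → A)
    (hinj : Function.Injective ξ) (hprim : IsPrimitiveSubst hq ξ)
    (α : A) (hα : ξ α ⟨0, hq⟩ = α)
    (u : ℕ → A) (hu0 : u 0 = α) (hufix : substApply hq ξ u = u)
    (μ : Measure (ℕ → A)) [IsProbabilityMeasure μ]
    (hμinv : MeasurePreserving (shiftMap A) μ μ)
    (hμsupp : μ (substOrbitClosure A u) = 1) :
    IsScalingEntropySeqM μ (shiftMap A)
      (fun n => 1 + ((substColumnNumber hq ξ : ℝ) - (substHeight hq ξ u : ℝ)) * Real.log n) := by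
  have hq2 := two_le_q hcard hq ξ hprim
  obtain ⟨m, k, hm, hk, hc⟩ := column_attained hq ξ
  have hle := (height_le_column hq ξ hprim hufix hk hc).1
  have hleR : (substHeight hq ξ u : ℝ) ≤ substColumnNumber hq ξ := by exact_mod_cast hle
  have hmeas : Measurable (fun p : (ℕ → A) × (ℕ → A) => rho0 p.1 p.2) := by
    have h1 : Measurable (fun z : A × A => if z.1 = z.2 then (0:ℝ) else 1) := measurable_of_finite _
    have h2 : Measurable (fun p : (ℕ → A) × (ℕ → A) => (p.1 0, p.2 0)) :=
      ((measurable_pi_apply 0).comp measurable_fst).prodMk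
        ((measurable_pi_apply 0).comp measurable_snd)
    exact h1.comp h2
  have hpos : ∀ n : ℕ, 1 ≤ n → 0 < 1 + ((substColumnNumber hq ξ : ℝ) -
      (substHeight hq ξ u : ℝ)) * Real.log n := by
    intro n hn
    have : 0 ≤ Real.log n := Real.log_nonneg (by exact_mod_cast hn)
    have := mul_nonneg (sub_nonneg.mpr hleR) this
    linarith
  refine ⟨rho0, rho0_semimetric, hmeas, ?_, ?_, ?_, hpos, ?_, ?_⟩
  · refine Integrable.of_bound hmeas.aestronglyMeasurable 1 (Eventually.of_forall fun p => ?_)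
    unfold rho0
    split_ifs <;> simp
  · refine ⟨univ, MeasurableSet.univ, by simp, Set.range (fun (a : A) (_ : ℕ) => a),
      Set.countable_range _, Set.subset_univ _, ?_⟩
    intro x _ ε hε
    exact ⟨fun _ => x 0, ⟨x 0, rfl⟩, by simpa [rho0] using hε⟩
  · refine ⟨univ, MeasurableSet.univ, by simp, ?_⟩
    intro x _ y _ hxy
    obtain ⟨k, hk⟩ := Function.ne_iff.mp hxy
    refine ⟨k, ?_⟩
    simp [rho0, shift_iter, hk]
  · intro ε hε
    rcases hle.eq_or_lt with heq | hlt
    · obtain ⟨C, hC, hev⟩ := upper_eq hq ξ hprim hufix μ hμsupp heq ε hε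
      refine limsup_fin _ _ C hC (hev.mono fun n hn => ?_)
      rw [heq]; simpa using hn
    · have hD : (1:ℝ) ≤ (substColumnNumber hq ξ : ℝ) - (substHeight hq ξ u : ℝ) := by
        have : ((substHeight hq ξ u + 1 : ℕ) : ℝ) ≤ substColumnNumber hq ξ := by exact_mod_cast hlt
        push_cast at this; linarith
      obtain ⟨C, hC, hev⟩ := upper_lt hq hq2 ξ hufix μ hμsupp ε hε _ hD
      exact limsup_fin _ _ C hC hev
  · rcases hle.eq_or_lt with heq | hlt
    · obtain ⟨ε₀, h0, h⟩ := lower_eq hcard hq hq2 ξ hprim hufix μ hμinv hμsupp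
      refine ⟨ε₀, h0, fun ε hε hlt => ?_⟩
      refine liminf_pos _ _ 1 one_pos hpos ((h ε hε hlt).mono fun n hn => ?_)
      rw [heq]; simpa using hn
    · obtain ⟨ε₀, h0, h⟩ := lower_lt hq hq2 ξ hprim hufix μ hμinv hμsupp hlt _
        (sub_nonneg.mpr hleR)
      refine ⟨ε₀, h0, fun ε hε hlt' => ?_⟩
      obtain ⟨δ, hδ, hev⟩ := h ε hε hlt'
      exact liminf_pos _ _ δ hδ hpos hev
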